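/- Let X be a random variable with density f belonging to the integrated Pearson family IP(μ; δ, β, γ) with δ ≤ 0, let m, n be nonnegative integers with n ≥ 1, and let g ∈ H^{m,n}(X). Then (−1)^n (Var[g(X)] − S_{m,n}(g)) ≥ 0. -/

import Mathlib

open MeasureTheory ProbabilityTheory Finset Filter

noncomputable section

/-- Falling factorial `(x)_k = x (x-1) ⋯ (x-k+1)`, with `(x)_0 = 1`. -/
def fall (x : ℝ) (k : ℕ) : ℝ := ∏ j ∈ Finset.range k, (x - j)

/-- Rising factorial `[x]_k = x (x+1) ⋯ (x+k-1)`, with `[x]_0 = 1`. -/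
def rise (x : ℝ) (k : ℕ) : ℝ := ∏ j ∈ Finset.range k, (x + j)

/-- The product `∏_{j=a}^{a+len-1} (1 - j δ)` of `len` consecutive factors
(an empty product is `1`). -/
def pp (δ a : ℝ) (len : ℕ) : ℝ := ∏ j ∈ Finset.range len, (1 - (a + j) * δ)

/-- The open real interval with (possibly infinite) endpoints `α ω : EReal`. -/
def erealIoo (α ω : EReal) : Set ℝ := {x : ℝ | α < (x : EReal) ∧ (x : EReal) < ω}

/-- `g` coincides on `J` with a polynomial of degree at most `d`. -/
def IsPolyOn (g : ℝ → ℝ) (J : Set ℝ) (d : ℕ) : Prop :=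
  ∃ p : Polynomial ℝ, p.natDegree ≤ d ∧ ∀ x ∈ J, g x = p.eval x

/-- The quadratic `q(x) = δ x² + β x + γ` of a Pearson family. -/
def pq (δ β γ : ℝ) : ℝ → ℝ := fun x => δ * x ^ 2 + β * x + γ

/-- `P` is the distribution of a random variable with density `f` (w.r.t. Lebesgue
measure) belonging to the integrated Pearson family `IP(μ; δ, β, γ)`:
`μ` is the (finite) mean of `P`, `|δ|+|β|+|γ| > 0`, and
`∫_{-∞}^x (μ - t) f(t) dt = q(x) f(x)` for all `x`. -/
def IsIntegratedPearson (P : Measure ℝ) (f : ℝ → ℝ) (μ δ β γ : ℝ) : Prop :=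
  IsProbabilityMeasure P ∧
  (∀ x, 0 ≤ f x) ∧
  P = volume.withDensity (fun x => ENNReal.ofReal (f x)) ∧
  Integrable (fun x : ℝ => x) P ∧
  μ = ∫ x, x ∂P ∧
  0 < |δ| + |β| + |γ| ∧
  ∀ x : ℝ, (∫ t in Set.Iic x, (μ - t) * f t) = pq δ β γ x * f x

/-- Membership in the class `H^{m,n}(X)` for the distribution `P` of `X` with Pearson
quadratic `q` and support `J`.  Here `gd k` plays the role of the `k`-th derivative
`g^{(k)}` of `g = gd 0` on `J`.  With `ℓ = max m n`:  `g ∈ C^{ℓ-1}(J)`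
(encoded by `gd k` having derivative `gd (k+1)` at every point of `J` for `k+1 < ℓ`,
and `gd (ℓ-1)` continuous on `J`), `g^{(ℓ-1)}` is absolutely continuous on `J` with
a.e. derivative `g^{(ℓ)} = gd ℓ` (encoded by the fundamental theorem of calculus:
`gd ℓ` is locally integrable and `gd (ℓ-1)` is its integral on every subinterval of `J`),
and the moment conditions `E[q(X)^n (g^{(n)}(X))²] < ∞` and
`E[q(X)^i |g^{(i)}(X)|] < ∞` for `n < i ≤ m` hold. -/
def MemH (P : Measure ℝ) (q : ℝ → ℝ) (J : Set ℝ) (m n : ℕ) (gd : ℕ → ℝ → ℝ) : Prop :=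
  (∀ k, k + 1 < max m n → ∀ x ∈ J, HasDerivAt (gd k) (gd (k + 1) x) x) ∧
  (1 ≤ max m n → ContinuousOn (gd (max m n - 1)) J) ∧
  (1 ≤ max m n → ∀ a ∈ J, ∀ b ∈ J,
    IntervalIntegrable (gd (max m n)) volume a b ∧
      gd (max m n - 1) b - gd (max m n - 1) a = ∫ t in a..b, gd (max m n) t) ∧
  Integrable (fun x => q x ^ n * (gd n x) ^ 2) P ∧
  ∀ i, n < i → i ≤ m → Integrable (fun x => q x ^ i * |gd i x|) P

/-- The variance bound `S_{m,n}(g)` of Theorem 2.1, for a Pearson distribution `P`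
with quadratic `q` and parameter `δ`. -/
def Sbound (P : Measure ℝ) (δ : ℝ) (q : ℝ → ℝ) (m n : ℕ) (gd : ℕ → ℝ → ℝ) : ℝ :=
  (∑ i ∈ Finset.Icc 1 m,
      ((m.choose i : ℝ) * pp δ ((m : ℝ) + i) n /
          (fall ((m : ℝ) + n) i * (∫ x, q x ^ i ∂P) * pp δ ((i : ℝ) - 1) i *
            pp δ (m : ℝ) n)) *
        (∫ x, q x ^ i * gd i x ∂P) ^ 2) +
    ∑ i ∈ Finset.Icc 1 n,
      (-1 : ℝ) ^ (i - 1) *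
          ((n.choose i : ℝ) / (fall ((m : ℝ) + n) i * pp δ (m : ℝ) i)) *
        ∫ x, q x ^ i * (gd i x) ^ 2 ∂P

/-! ### Algebraic part -/

namespace PAlg
open Polynomial

/-- the quadratic as a polynomial -/
def Q (δ β γ : ℝ) : ℝ[X] := C δ * X ^ 2 + C β * X + C γ

/-- adjoint of derivative -/
def M (δ β γ μ : ℝ) (i : ℕ) (r : ℝ[X]) : ℝ[X] :=
  (C (1 - 2 * i * δ) * X - C (μ + i * β)) * r - Q δ β γ * derivative r

/-- eigenvalues -/
def lam (δ : ℝ) (k : ℕ) : ℝ := k * (1 - ((k : ℝ) - 1) * δ)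

lemma lam_sub (δ : ℝ) (k j : ℕ) :
    lam δ k - lam δ j = ((k : ℝ) - j) * (1 - ((k : ℝ) + j - 1) * δ) := by
  unfold lam; ring

lemma lam_ne {δ : ℝ} (hδ : δ ≤ 0) {k j : ℕ} (h : k ≠ j) : lam δ k - lam δ j ≠ 0 := by
  rw [lam_sub]
  have h1 : (1 : ℝ) ≤ (k : ℝ) + j := by
    have : 1 ≤ k + j := by omega
    exact_mod_cast this
  apply mul_ne_zero
  · rw [sub_ne_zero]; exact_mod_cast h
  · nlinarith

lemma lam_lt {δ : ℝ} (hδ : δ ≤ 0) {k j : ℕ} (h : k < j) : lam δ k < lam δ j := by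
  rw [← sub_pos, lam_sub]
  have h1 : (1 : ℝ) ≤ (j : ℝ) + k := by
    have : 1 ≤ j + k := by omega
    exact_mod_cast this
  have h2 : (k : ℝ) < j := by exact_mod_cast h
  apply mul_pos
  · linarith
  · nlinarith

lemma lam_zero (δ : ℝ) : lam δ 0 = 0 := by simp [lam]

variable {δ β γ μ : ℝ}

lemma derivative_Q : derivative (Q δ β γ) = C (2 * δ) * X + C β := by
  simp only [Q, derivative_add, derivative_C_mul, derivative_X_pow, derivative_X, derivative_C,
    mul_one, add_zero, Nat.cast_ofNat, map_mul]
  norm_num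
  ring

lemma step (I : ℝ[X] →ₗ[ℝ] ℝ)
    (hst : ∀ p, I (Q δ β γ * derivative p) = I ((X - C μ) * p)) (i : ℕ) (p r : ℝ[X]) :
    I (Q δ β γ ^ (i + 1) * (derivative p * r)) = I (Q δ β γ ^ i * (p * M δ β γ μ i r)) := by
  have h := hst (Q δ β γ ^ i * (p * r))
  have e1 : Q δ β γ * derivative (Q δ β γ ^ i * (p * r)) =
      Q δ β γ ^ (i + 1) * (derivative p * r) + Q δ β γ ^ i * (p * (Q δ β γ * derivative r
        + C (i : ℝ) * (C (2 * δ) * X + C β) * r)) := by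
    rw [derivative_mul, derivative_mul, derivative_pow, derivative_Q]
    rcases i with _ | i
    · simp; ring
    · simp only [Nat.add_sub_cancel]
      ring
  have e2 : Q δ β γ ^ i * (p * M δ β γ μ i r) = (X - C μ) * (Q δ β γ ^ i * (p * r)) -
      Q δ β γ ^ i * (p * (Q δ β γ * derivative r
        + C (i : ℝ) * (C (2 * δ) * X + C β) * r)) := by
    unfold M
    have : C (1 - 2 * (i : ℝ) * δ) * X - C (μ + i * β) =
      X - C μ - C (i : ℝ) * (C (2 * δ) * X + C β) := by
        simp only [map_sub, map_mul, map_add, map_one, C_ofNat]; ring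
    rw [this]
    ring
  rw [e2, map_sub, ← h, e1, map_add]
  ring

lemma comm (i : ℕ) (p : ℝ[X]) :
    derivative (M δ β γ μ i (derivative p)) =
      M δ β γ μ (i + 1) (derivative (derivative p)) + C (1 - 2 * i * δ) * derivative p := by
  unfold M
  rw [derivative_sub, derivative_mul, derivative_mul, derivative_Q]
  have : derivative (C (1 - 2 * (i : ℝ) * δ) * X - C (μ + i * β)) = C (1 - 2 * (i : ℝ) * δ) := by
    rw [derivative_sub, derivative_C, derivative_C_mul, derivative_X]; ring
  rw [this]
  have : C (1 - 2 * ((i + 1 : ℕ) : ℝ) * δ) * X - C (μ + ((i + 1 : ℕ) : ℝ) * β) =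
      C (1 - 2 * (i : ℝ) * δ) * X - C (μ + i * β) - (C (2 * δ) * X + C β) := by
    push_cast
    simp only [map_sub, map_mul, map_add, map_one, C_ofNat]; ring
  rw [this]
  ring

lemma lam_succ (i : ℕ) : lam δ (i + 1) = lam δ i + (1 - 2 * i * δ) := by
  unfold lam; push_cast; ring

lemma eig_iter {l : ℝ} {u : ℝ[X]} (hu : M δ β γ μ 0 (derivative u) = C l * u) (i : ℕ) :
    M δ β γ μ i (derivative (derivative^[i] u)) = C (l - lam δ i) * derivative^[i] u := by
  induction i with
  | zero => simpa [lam] using hu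
  | succ i ih =>
    have h := congrArg derivative ih
    rw [comm] at h
    rw [Function.iterate_succ_apply']
    rw [derivative_C_mul] at h
    rw [lam_succ]
    rw [eq_sub_of_add_eq h, ← sub_mul, ← map_sub]
    congr 2; ring

lemma eig_prod (I : ℝ[X] →ₗ[ℝ] ℝ)
    (hst : ∀ p, I (Q δ β γ * derivative p) = I ((X - C μ) * p)) {l : ℝ} {u : ℝ[X]}
    (hu : M δ β γ μ 0 (derivative u) = C l * u) (v : ℝ[X]) (i : ℕ) :
    I (Q δ β γ ^ i * (derivative^[i] v * derivative^[i] u)) =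
      (∏ k ∈ range i, (l - lam δ k)) * I (v * u) := by
  induction i with
  | zero => simp
  | succ i ih =>
    rw [Function.iterate_succ_apply', Function.iterate_succ_apply', step I hst, eig_iter hu,
      prod_range_succ]
    have : Q δ β γ ^ i * (derivative^[i] v * (C (l - lam δ i) * derivative^[i] u)) =
      (l - lam δ i) • (Q δ β γ ^ i * (derivative^[i] v * derivative^[i] u)) := by
      rw [smul_eq_C_mul]; ring
    rw [this, map_smul, ih, smul_eq_mul]; ring

lemma eig_orth (I : ℝ[X] →ₗ[ℝ] ℝ)
    (hst : ∀ p, I (Q δ β γ * derivative p) = I ((X - C μ) * p)) {l l' : ℝ} {u v : ℝ[X]}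
    (hu : M δ β γ μ 0 (derivative u) = C l * u) (hv : M δ β γ μ 0 (derivative v) = C l' * v)
    (hne : l ≠ l') : I (v * u) = 0 := by
  have h1 := eig_prod I hst hu v 1
  have h2 := eig_prod I hst hv u 1
  simp only [Function.iterate_one, pow_one, range_one, prod_singleton, lam_zero, sub_zero] at h1 h2
  rw [mul_comm (derivative u), mul_comm u] at h2
  rw [h1] at h2
  by_contra h0
  exact hne (mul_right_cancel₀ h0 h2)

lemma eig_mean (I : ℝ[X] →ₗ[ℝ] ℝ)
    (hst : ∀ p, I (Q δ β γ * derivative p) = I ((X - C μ) * p)) {l : ℝ} {u : ℝ[X]}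
    (hu : M δ β γ μ 0 (derivative u) = C l * u) (i : ℕ) (hl : l - lam δ i ≠ 0) :
    I (Q δ β γ ^ i * derivative^[i] u) = 0 := by
  have h := step I hst i 1 (derivative (derivative^[i] u))
  rw [eig_iter hu] at h
  simp only [derivative_one, zero_mul, mul_zero, map_zero, one_mul] at h
  have : Q δ β γ ^ i * (C (l - lam δ i) * derivative^[i] u) =
      (l - lam δ i) • (Q δ β γ ^ i * (derivative^[i] u)) := by
      rw [smul_eq_C_mul]; ring
  rw [this, map_smul, smul_eq_mul] at h
  exact (mul_eq_zero.mp h.symm).resolve_left hl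

lemma coeff_L (p : ℝ[X]) (k : ℕ) :
    (M δ β γ μ 0 (derivative p)).coeff k = lam δ k * p.coeff k
      - (μ + β * k) * (k + 1) * p.coeff (k + 1)
      - γ * ((k + 1) * (k + 2)) * p.coeff (k + 2) := by
  have e : M δ β γ μ 0 (derivative p) = X * derivative p - C μ * derivative p
    - C δ * (derivative (derivative p) * X ^ 2) - C β * (X * derivative (derivative p))
    - C γ * derivative (derivative p) := by
    simp [M, Q]; ring
  rw [e]
  simp only [coeff_sub, coeff_C_mul]
  rcases k with _ | _ | k
  · simp [coeff_derivative, lam]; ring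
  · rw [coeff_X_mul, coeff_X_mul, coeff_mul_X_pow']
    simp [coeff_derivative, lam]; ring
  · rw [show k + 1 + 1 = (k + 1) + 1 from rfl, coeff_X_mul, coeff_X_mul, show k + 1 + 1 = k + 2 from rfl,
      coeff_mul_X_pow]
    simp [coeff_derivative, lam]; ring

lemma degree_C_mul_le (c : ℝ) (p : ℝ[X]) : (C c * p).degree ≤ p.degree := by
  rw [← smul_eq_C_mul]; exact degree_smul_le c p

lemma decomp (hδ : δ ≤ 0) (N : ℕ) : ∀ p : ℝ[X], p.degree < N → ∃ u : ℕ → ℝ[X],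
    (∀ j, M δ β γ μ 0 (derivative (u j)) = C (lam δ j) * u j ∧ (u j).degree ≤ j) ∧
    p = ∑ j ∈ range N, u j := by
  induction N with
  | zero =>
    intro p hp
    refine ⟨fun _ => 0, fun j => by simp [M], ?_⟩
    simpa using hp
  | succ N ih =>
    intro p hp
    rw [degree_lt_iff_coeff_zero] at hp
    obtain ⟨v, hv, hvs⟩ := ih (M δ β γ μ 0 (derivative p) - C (lam δ N) * p) (by
      rw [degree_lt_iff_coeff_zero]
      intro k hk
      rw [coeff_sub, coeff_L, coeff_C_mul, hp (k + 1) (by omega), hp (k + 2) (by omega)]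
      rcases eq_or_lt_of_le hk with h | h
      · subst h; ring
      · rw [hp k (by omega)]; ring)
    have Mlin : ∀ (s : Finset ℕ) (F : ℕ → ℝ[X]), M δ β γ μ 0 (derivative (∑ j ∈ s, F j)) =
        ∑ j ∈ s, M δ β γ μ 0 (derivative (F j)) := by
      intro s F
      simp only [M, derivative_sum, mul_sum, sum_sub_distrib]
    have Msub : ∀ a b : ℝ[X], M δ β γ μ 0 (derivative (a - b)) =
        M δ β γ μ 0 (derivative a) - M δ β γ μ 0 (derivative b) := by
      intro a b; simp only [M, derivative_sub]; ring
    have MC : ∀ (c : ℝ) (a : ℝ[X]), M δ β γ μ 0 (derivative (C c * a)) =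
        C c * M δ β γ μ 0 (derivative a) := by
      intro c a; simp only [M, derivative_C_mul]; ring
    set w : ℕ → ℝ[X] := fun j => C ((lam δ j - lam δ N)⁻¹) * v j with hw
    have hwM : ∀ j, M δ β γ μ 0 (derivative (w j)) = C (lam δ j) * w j := by
      intro j; rw [hw]; simp only; rw [MC, (hv j).1]; ring
    have hwd : ∀ j, (w j).degree ≤ j := by
      intro j
      rw [hw]; simp only
      refine (degree_C_mul_le _ _).trans (hv j).2
    refine ⟨fun j => if j = N then p - ∑ j ∈ range N, w j else w j, ?_, ?_⟩
    · intro j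
      by_cases hj : j = N
      · subst hj
        simp only [if_true]
        constructor
        · rw [Msub, Mlin]
          have h1 : ∑ i ∈ range j, M δ β γ μ 0 (derivative (w i)) =
              (∑ i ∈ range j, v i) + C (lam δ j) * ∑ i ∈ range j, w i := by
            rw [mul_sum, ← sum_add_distrib]
            refine sum_congr rfl fun i hi => ?_
            rw [hwM]
            have hne : lam δ i - lam δ j ≠ 0 := lam_ne hδ (by have := mem_range.1 hi; omega)
            have : v i = C (lam δ i - lam δ j) * w i := by
              rw [hw]; simp only; rw [← mul_assoc, ← map_mul, mul_inv_cancel₀ hne]; simp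
            rw [this, map_sub]; ring
          rw [h1, ← hvs]; ring
        · refine (degree_sub_le _ _).trans (max_le ?_ ?_)
          · rw [degree_le_iff_coeff_zero]
            intro k hk
            exact hp k (by exact_mod_cast hk)
          · refine (degree_sum_le _ _).trans (Finset.sup_le fun i hi => ?_)
            refine (hwd i).trans ?_
            exact_mod_cast (mem_range.1 hi).le
      · simp only [hj, if_false]
        exact ⟨hwM j, hwd j⟩
    · rw [sum_range_succ]
      simp only [if_true]
      rw [sum_congr rfl (g := w) (fun i hi => by
        rw [if_neg]; have := mem_range.1 hi; omega)]
      ring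

end PAlg

namespace PAlg
open Polynomial

lemma fall_succ (x : ℝ) (i : ℕ) : fall x (i + 1) = fall x i * (x - i) := by
  simp [fall, prod_range_succ]

lemma fall_succ' (x : ℝ) (i : ℕ) : fall (x + 1) (i + 1) = (x + 1) * fall x i := by
  unfold fall
  rw [prod_range_succ']
  rw [mul_comm]
  congr 1
  · simp
  · refine prod_congr rfl fun j _ => ?_
    push_cast; ring

lemma fall_pos {x : ℝ} {i : ℕ} (h : (i : ℝ) ≤ x) : 0 < fall x i := by
  unfold fall
  refine prod_pos fun j hj => ?_
  have : (j : ℝ) + 1 ≤ i := by exact_mod_cast mem_range.1 hj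
  linarith

lemma pp_pos {δ a : ℝ} (hδ : δ ≤ 0) (len : ℕ) (ha : 0 ≤ a) : 0 < pp δ a len := by
  unfold pp
  refine prod_pos fun j _ => ?_
  have : 0 ≤ a + j := by positivity
  nlinarith

lemma lam_pos {δ : ℝ} (hδ : δ ≤ 0) {k : ℕ} (hk : 0 < k) : 0 < lam δ k := by
  have := lam_lt hδ hk
  rwa [lam_zero] at this

lemma coef_rec {δ : ℝ} (hδ : δ ≤ 0) (m n i : ℕ) (hi : i ≤ n) :
    ((n + 1).choose (i + 1) : ℝ) / (fall ((m : ℝ) + (n + 1 : ℕ)) (i + 1) * pp δ m (i + 1)) =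
    (n.choose (i + 1) : ℝ) / (fall ((m : ℝ) + n) (i + 1) * pp δ m (i + 1)) *
      (1 - lam δ (i + 1) / lam δ (m + 1 + n)) +
    (n.choose i : ℝ) / (fall ((m : ℝ) + n) i * pp δ m i) / lam δ (m + 1 + n) := by
  have hF : 0 < fall ((m : ℝ) + n) i := fall_pos (by
    have : i ≤ m + n := by omega
    exact_mod_cast this)
  have hP : 0 < pp δ (m : ℝ) i := pp_pos hδ _ (by positivity)
  have he : 0 < 1 - ((m : ℝ) + i) * δ := by
    have : (0 : ℝ) ≤ (m : ℝ) + i := by positivity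
    nlinarith
  have hM : 0 < 1 - ((m : ℝ) + n) * δ := by
    have : (0 : ℝ) ≤ (m : ℝ) + n := by positivity
    nlinarith
  have hM1 : (0 : ℝ) < (m : ℝ) + n + 1 := by positivity
  have hL : lam δ (m + 1 + n) = ((m : ℝ) + n + 1) * (1 - ((m : ℝ) + n) * δ) := by
    unfold lam; push_cast; ring
  have e1 : fall ((m : ℝ) + (n + 1 : ℕ)) (i + 1) = ((m : ℝ) + n + 1) * fall ((m : ℝ) + n) i := by
    push_cast; rw [← add_assoc, fall_succ']
  have e2 : pp δ (m : ℝ) (i + 1) = pp δ m i * (1 - ((m : ℝ) + i) * δ) := by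
    simp [pp, prod_range_succ]
  have hc : ((i : ℝ) + 1) * (n.choose (i + 1)) = ((n : ℝ) - i) * n.choose i := by
    have := Nat.choose_succ_right_eq n i
    have h2 : ((n.choose (i + 1) * (i + 1) : ℕ) : ℝ) = ((n.choose i * (n - i) : ℕ) : ℝ) := by
      rw [this]
    push_cast [Nat.cast_sub hi] at h2
    linarith
  have hp : ((n + 1).choose (i + 1) : ℝ) = n.choose i + n.choose (i + 1) := by
    rw [Nat.choose_succ_succ]; push_cast; ring
  rw [e1, e2, fall_succ, hp, hL]
  have hl : lam δ (i + 1) = ((i : ℝ) + 1) * (1 - i * δ) := by unfold lam; push_cast; ring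
  rw [hl]
  rcases eq_or_lt_of_le hi with h | h
  · subst h
    rw [Nat.choose_succ_self]
    simp only [Nat.choose_self, Nat.cast_zero, Nat.cast_one, zero_div, zero_mul, zero_add, add_zero]
    field_simp
  · have h3 : (0 : ℝ) < (m : ℝ) + n - i := by
      have : (i : ℝ) < n := by exact_mod_cast h
      have : (0 : ℝ) ≤ m := by positivity
      linarith
    field_simp
    linear_combination (δ * ((m : ℝ) + n - i)) * hc

lemma R_id {δ : ℝ} (hδ : δ ≤ 0) (m n : ℕ) (l : ℝ) :
    ∑ i ∈ range (n + 1), (-1 : ℝ) ^ i *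
      ((n.choose i : ℝ) / (fall ((m : ℝ) + n) i * pp δ (m : ℝ) i)) *
        (∏ k ∈ range i, (l - lam δ k)) = ∏ s ∈ range n, (1 - l / lam δ (m + 1 + s)) := by
  induction n with
  | zero => simp [fall, pp]
  | succ n ih =>
    rw [prod_range_succ, ← ih, sum_range_succ' _ (n + 1)]
    have hL : lam δ (m + 1 + n) ≠ 0 := (lam_pos hδ (by omega)).ne'
    have e1 : ∀ i ∈ range (n + 1), (-1 : ℝ) ^ (i + 1) *
      (((n + 1).choose (i + 1) : ℝ) / (fall ((m : ℝ) + (n + 1 : ℕ)) (i + 1) * pp δ (m : ℝ) (i + 1))) *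
        (∏ k ∈ range (i + 1), (l - lam δ k)) =
      ((-1 : ℝ) ^ (i + 1) *
      ((n.choose (i + 1) : ℝ) / (fall ((m : ℝ) + n) (i + 1) * pp δ (m : ℝ) (i + 1))) *
        (∏ k ∈ range (i + 1), (l - lam δ k))) * (1 - lam δ (i + 1) / lam δ (m + 1 + n)) -
      ((-1 : ℝ) ^ i *
      ((n.choose i : ℝ) / (fall ((m : ℝ) + n) i * pp δ (m : ℝ) i)) *
        (∏ k ∈ range i, (l - lam δ k))) * ((l - lam δ i) / lam δ (m + 1 + n)) := by
      intro i hi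
      rw [coef_rec hδ m n i (by have := mem_range.1 hi; omega)]
      rw [prod_range_succ _ i, pow_succ]
      ring
    rw [sum_congr rfl e1, sum_sub_distrib]
    have e2 := sum_range_succ' (fun i => ((-1 : ℝ) ^ i *
      ((n.choose i : ℝ) / (fall ((m : ℝ) + n) i * pp δ (m : ℝ) i)) *
        (∏ k ∈ range i, (l - lam δ k))) * (1 - lam δ i / lam δ (m + 1 + n))) (n + 1)
    have e3 := sum_range_succ (fun i => ((-1 : ℝ) ^ i *
      ((n.choose i : ℝ) / (fall ((m : ℝ) + n) i * pp δ (m : ℝ) i)) *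
        (∏ k ∈ range i, (l - lam δ k))) * (1 - lam δ i / lam δ (m + 1 + n))) (n + 1)
    rw [e3] at e2
    simp only [Nat.choose_succ_self, Nat.cast_zero, zero_div, mul_zero, zero_mul, add_zero] at e2
    rw [eq_sub_of_add_eq e2.symm, sum_mul]
    have e4 : ∀ i ∈ range (n + 1), ((-1 : ℝ) ^ i *
      ((n.choose i : ℝ) / (fall ((m : ℝ) + n) i * pp δ (m : ℝ) i)) *
        (∏ k ∈ range i, (l - lam δ k))) * (1 - l / lam δ (m + 1 + n)) =
       ((-1 : ℝ) ^ i *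
      ((n.choose i : ℝ) / (fall ((m : ℝ) + n) i * pp δ (m : ℝ) i)) *
        (∏ k ∈ range i, (l - lam δ k))) * (1 - lam δ i / lam δ (m + 1 + n)) -
       ((-1 : ℝ) ^ i *
      ((n.choose i : ℝ) / (fall ((m : ℝ) + n) i * pp δ (m : ℝ) i)) *
        (∏ k ∈ range i, (l - lam δ k))) * ((l - lam δ i) / lam δ (m + 1 + n)) := by
      intro i _; field_simp; ring
    rw [sum_congr rfl e4, sum_sub_distrib]
    simp [fall, pp, lam_zero]
    ring

lemma choose_fall (m i : ℕ) (h : i ≤ m) : (m.choose i : ℝ) * (i.factorial : ℝ) = fall m i := by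
  induction i with
  | zero => simp [fall]
  | succ i ih =>
    rw [fall_succ, ← ih (by omega)]
    have h2 : ((m.choose (i + 1) * (i + 1) : ℕ) : ℝ) = ((m.choose i * (m - i) : ℕ) : ℝ) := by
      rw [Nat.choose_succ_right_eq]
    push_cast [Nat.cast_sub (show i ≤ m by omega)] at h2
    rw [Nat.factorial_succ]; push_cast
    linear_combination (i.factorial : ℝ) * h2

lemma comb_prod (m n i : ℕ) (h : i ≤ m) :
    (m.choose i : ℝ) * (i.factorial : ℝ) / fall ((m : ℝ) + n) i =
      ∏ s ∈ range n, (((m : ℝ) + 1 + s - i) / ((m : ℝ) + 1 + s)) := by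
  have h' : (i : ℝ) ≤ m := by exact_mod_cast h
  induction n with
  | zero =>
    rw [choose_fall m i h]
    simp
    exact (fall_pos h').ne'
  | succ n ih =>
    rw [prod_range_succ, ← ih]
    have h1 : fall ((m : ℝ) + n + 1) i * ((m : ℝ) + n + 1 - i) = ((m : ℝ) + n + 1) * fall ((m : ℝ) + n) i := by
      rw [← fall_succ, fall_succ']
    have hp1 : 0 < fall ((m : ℝ) + n) i := fall_pos (by have : (0 : ℝ) ≤ n := by positivity
                                                        linarith)
    have hp2 : 0 < fall ((m : ℝ) + n + 1) i := fall_pos (by have : (0 : ℝ) ≤ n := by positivity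
                                                            linarith)
    have h3 : (0 : ℝ) < (m : ℝ) + 1 + n := by positivity
    push_cast
    rw [← add_assoc]
    rw [div_mul_div_comm, div_eq_div_iff hp2.ne' (by positivity)]
    linear_combination (-(m.choose i : ℝ) * (i.factorial : ℝ)) * h1

lemma Pi_eq (δ : ℝ) (i : ℕ) :
    ∏ k ∈ range i, (lam δ i - lam δ k) = (i.factorial : ℝ) * pp δ ((i : ℝ) - 1) i := by
  have h : (i.factorial : ℝ) = ∏ k ∈ range i, ((i : ℝ) - k) := by
    have := choose_fall i i le_rfl
    simpa [fall] using this
  rw [h, pp, ← prod_mul_distrib]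
  refine prod_congr rfl fun k _ => ?_
  rw [lam_sub]; ring

lemma A_eq {δ : ℝ} (hδ : δ ≤ 0) (m n i : ℕ) (h : i ≤ m) {Iq : ℝ} (hI : 0 < Iq) :
    (m.choose i : ℝ) * pp δ ((m : ℝ) + i) n /
          (fall ((m : ℝ) + n) i * Iq * pp δ ((i : ℝ) - 1) i * pp δ (m : ℝ) n) *
      (Iq * ∏ k ∈ range i, (lam δ i - lam δ k)) =
    ∏ s ∈ range n, (1 - lam δ i / lam δ (m + 1 + s)) := by
  have h' : (i : ℝ) ≤ m := by exact_mod_cast h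
  have e1 : ∏ s ∈ range n, (1 - lam δ i / lam δ (m + 1 + s)) =
      (∏ s ∈ range n, (((m : ℝ) + 1 + s - i) / ((m : ℝ) + 1 + s))) *
        (pp δ ((m : ℝ) + i) n / pp δ m n) := by
    unfold pp
    rw [← prod_div_distrib, ← prod_mul_distrib]
    refine prod_congr rfl fun s _ => ?_
    have hp := lam_pos hδ (k := m + 1 + s) (by omega)
    rw [one_sub_div hp.ne', lam_sub]
    have hl : lam δ (m + 1 + s) = ((m : ℝ) + 1 + s) * (1 - ((m : ℝ) + s) * δ) := by
      unfold lam; push_cast; ring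
    rw [hl, div_mul_div_comm]
    push_cast
    congr 2
    ring
  rw [e1, ← comb_prod m n i h, Pi_eq]
  have hp1 : 0 < fall ((m : ℝ) + n) i := fall_pos (by
    have : (0 : ℝ) ≤ n := by positivity
    linarith)
  have hp2 : 0 < pp δ (m : ℝ) n := pp_pos hδ _ (by positivity)
  have hp3 : 0 < pp δ ((i : ℝ) - 1) i := by
    rcases i with _ | i
    · simp [pp]
    · exact pp_pos hδ _ (by push_cast; simp)
  field_simp

lemma R_sign {δ : ℝ} (hδ : δ ≤ 0) (m n j : ℕ) (hj : m < j) :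
    0 ≤ (-1 : ℝ) ^ n * ∏ s ∈ range n, (1 - lam δ j / lam δ (m + 1 + s)) := by
  by_cases h : j ≤ m + n
  · rw [prod_eq_zero (i := j - m - 1) (mem_range.2 (by omega))]
    · simp
    · rw [show m + 1 + (j - m - 1) = j by omega, div_self (lam_pos hδ (by omega)).ne', sub_self]
  · have : (-1 : ℝ) ^ n = ∏ s ∈ range n, (-1 : ℝ) := by simp
    rw [this, ← prod_mul_distrib]
    refine prod_nonneg fun s hs => ?_
    have hs := mem_range.1 hs
    have h1 := lam_pos hδ (k := m + 1 + s) (by omega)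
    have h2 := lam_lt hδ (k := m + 1 + s) (j := j) (by omega)
    have : 1 ≤ lam δ j / lam δ (m + 1 + s) := (one_le_div h1).2 h2.le
    linarith

theorem poly_ineq {δ β γ μ : ℝ} (hδ : δ ≤ 0) (I : ℝ[X] →ₗ[ℝ] ℝ)
    (hst : ∀ p, I (Q δ β γ * derivative p) = I ((X - C μ) * p))
    (hpos : ∀ p, 0 ≤ I (p * p)) (h1 : I 1 = 1) (m n : ℕ)
    (hQ : ∀ i, 0 < I (Q δ β γ ^ i)) (p : ℝ[X]) :
    0 ≤ (-1 : ℝ) ^ n * (I (p * p) - (I p) ^ 2 -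
      ((∑ i ∈ Finset.Icc 1 m,
        ((m.choose i : ℝ) * pp δ ((m : ℝ) + i) n /
          (fall ((m : ℝ) + n) i * I (Q δ β γ ^ i) * pp δ ((i : ℝ) - 1) i *
            pp δ (m : ℝ) n)) * (I (Q δ β γ ^ i * derivative^[i] p)) ^ 2) +
      ∑ i ∈ Finset.Icc 1 n,
      (-1 : ℝ) ^ (i - 1) *
          ((n.choose i : ℝ) / (fall ((m : ℝ) + n) i * pp δ (m : ℝ) i)) *
        I (Q δ β γ ^ i * (derivative^[i] p * derivative^[i] p)))) := by
  obtain ⟨u, hu, hpu⟩ := decomp (β := β) (γ := γ) (μ := μ) hδ (max (m + 1) (p.natDegree + 1)) p (by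
    refine lt_of_le_of_lt degree_le_natDegree ?_
    exact_mod_cast lt_of_lt_of_le (Nat.lt_succ_self _) (le_max_right _ _))
  set N := max (m + 1) (p.natDegree + 1)
  have hN : m + 1 ≤ N := le_max_left _ _
  set s : ℕ → ℝ := fun j => I (u j * u j) with hs
  have hT : ∀ i, I (Q δ β γ ^ i * (derivative^[i] p * derivative^[i] p)) =
      ∑ j ∈ range N, (∏ k ∈ range i, (lam δ j - lam δ k)) * s j := by
    intro i
    have e : I (Q δ β γ ^ i * (derivative^[i] p * derivative^[i] p)) =
        ∑ j ∈ range N, I (Q δ β γ ^ i * (derivative^[i] p * derivative^[i] (u j))) := by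
      conv_lhs => rw [show derivative^[i] p * derivative^[i] p = derivative^[i] p *
        derivative^[i] (∑ j ∈ range N, u j) by rw [← hpu]]
      rw [iterate_derivative_sum, mul_sum, mul_sum, map_sum]
    rw [e]
    refine sum_congr rfl fun j hj => ?_
    rw [eig_prod I hst (hu j).1]
    congr 1
    conv_lhs => rw [hpu]
    rw [sum_mul, map_sum]
    rw [sum_eq_single j]
    · intro k _ hk
      exact eig_orth I hst (hu j).1 (hu k).1 (by
        have := lam_ne hδ hk.symm
        rwa [sub_ne_zero] at this)
    · intro h; exact absurd hj h
  have hE : ∀ i, i ≤ m → (I (Q δ β γ ^ i * derivative^[i] p)) ^ 2 =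
      (I (Q δ β γ ^ i) * ∏ k ∈ range i, (lam δ i - lam δ k)) * s i := by
    intro i hi
    have e : I (Q δ β γ ^ i * derivative^[i] p) = I (Q δ β γ ^ i * derivative^[i] (u i)) := by
      conv_lhs => rw [hpu]
      rw [iterate_derivative_sum, mul_sum, map_sum, sum_eq_single i]
      · intro k _ hk
        exact eig_mean I hst (hu k).1 i (lam_ne hδ hk)
      · intro h; exact absurd (mem_range.2 (by omega)) h
    obtain ⟨c, hc⟩ : ∃ c : ℝ, derivative^[i] (u i) = C c := by
      refine ⟨_, eq_C_of_degree_le_zero ?_⟩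
      have hd : (u i).natDegree ≤ i := natDegree_le_of_degree_le (hu i).2
      have := natDegree_iterate_derivative (u i) i
      rw [← natDegree_eq_zero_iff_degree_le_zero]
      omega
    have h2 := eig_prod I hst (hu i).1 (u i) i
    rw [e, mul_assoc]
    rw [hs]
    simp only
    rw [← h2, hc]
    have a1 : Q δ β γ ^ i * C c = c • Q δ β γ ^ i := by rw [smul_eq_C_mul]; ring
    have a2 : Q δ β γ ^ i * (C c * C c) = (c * c) • Q δ β γ ^ i := by
      rw [smul_eq_C_mul, map_mul]; ring
    rw [a1, a2, map_smul, map_smul, smul_eq_mul, smul_eq_mul]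
    ring
  have hsum : I (p * p) - (I p) ^ 2 -
      ((∑ i ∈ Finset.Icc 1 m,
        ((m.choose i : ℝ) * pp δ ((m : ℝ) + i) n /
          (fall ((m : ℝ) + n) i * I (Q δ β γ ^ i) * pp δ ((i : ℝ) - 1) i *
            pp δ (m : ℝ) n)) * (I (Q δ β γ ^ i * derivative^[i] p)) ^ 2) +
      ∑ i ∈ Finset.Icc 1 n,
      (-1 : ℝ) ^ (i - 1) *
          ((n.choose i : ℝ) / (fall ((m : ℝ) + n) i * pp δ (m : ℝ) i)) *
        I (Q δ β γ ^ i * (derivative^[i] p * derivative^[i] p))) =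
      ∑ i ∈ range (n + 1), (-1 : ℝ) ^ i *
          ((n.choose i : ℝ) / (fall ((m : ℝ) + n) i * pp δ (m : ℝ) i)) *
        I (Q δ β γ ^ i * (derivative^[i] p * derivative^[i] p)) -
      ∑ i ∈ range (m + 1), ((m.choose i : ℝ) * pp δ ((m : ℝ) + i) n /
          (fall ((m : ℝ) + n) i * I (Q δ β γ ^ i) * pp δ ((i : ℝ) - 1) i *
            pp δ (m : ℝ) n)) * (I (Q δ β γ ^ i * derivative^[i] p)) ^ 2 := by
    have hIcc : ∀ (k : ℕ) (F : ℕ → ℝ), ∑ i ∈ range (k + 1), F i = F 0 + ∑ i ∈ Finset.Icc 1 k, F i := by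
      intro k F
      rw [sum_range_succ', add_comm, Finset.range_eq_Ico, Finset.sum_Ico_add' F 0 k 1]
      rfl
    rw [hIcc, hIcc]
    have hpp : pp δ (m : ℝ) n ≠ 0 := (pp_pos hδ _ (by positivity)).ne'
    have : ∑ i ∈ Finset.Icc 1 n, (-1 : ℝ) ^ i *
          ((n.choose i : ℝ) / (fall ((m : ℝ) + n) i * pp δ (m : ℝ) i)) *
        I (Q δ β γ ^ i * (derivative^[i] p * derivative^[i] p)) =
        - ∑ i ∈ Finset.Icc 1 n, (-1 : ℝ) ^ (i - 1) *
          ((n.choose i : ℝ) / (fall ((m : ℝ) + n) i * pp δ (m : ℝ) i)) *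
        I (Q δ β γ ^ i * (derivative^[i] p * derivative^[i] p)) := by
      rw [← sum_neg_distrib]
      refine sum_congr rfl fun i hi => ?_
      obtain ⟨k, rfl⟩ : ∃ k, i = k + 1 := ⟨i - 1, by have := (Finset.mem_Icc.1 hi).1; omega⟩
      rw [Nat.add_sub_cancel, pow_succ]; ring
    rw [this]
    simp [fall, pp, h1]
    rw [div_self (by simpa [pp] using hpp)]
    ring
  rw [hsum]
  have e1 : ∑ i ∈ range (n + 1), (-1 : ℝ) ^ i *
          ((n.choose i : ℝ) / (fall ((m : ℝ) + n) i * pp δ (m : ℝ) i)) *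
        I (Q δ β γ ^ i * (derivative^[i] p * derivative^[i] p)) =
      ∑ j ∈ range N, (∏ t ∈ range n, (1 - lam δ j / lam δ (m + 1 + t))) * s j := by
    simp_rw [hT, mul_sum]
    rw [sum_comm]
    refine sum_congr rfl fun j _ => ?_
    rw [← R_id hδ m n, sum_mul]
    refine sum_congr rfl fun i _ => ?_
    ring
  have e2 : ∑ i ∈ range (m + 1), ((m.choose i : ℝ) * pp δ ((m : ℝ) + i) n /
          (fall ((m : ℝ) + n) i * I (Q δ β γ ^ i) * pp δ ((i : ℝ) - 1) i *
            pp δ (m : ℝ) n)) * (I (Q δ β γ ^ i * derivative^[i] p)) ^ 2 =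
      ∑ j ∈ range (m + 1), (∏ t ∈ range n, (1 - lam δ j / lam δ (m + 1 + t))) * s j := by
    refine sum_congr rfl fun i hi => ?_
    have hi : i ≤ m := by have := mem_range.1 hi; omega
    rw [hE i hi, ← mul_assoc, A_eq hδ m n i hi (hQ i)]
  rw [e1, e2, ← sum_range_add_sum_Ico _ hN]
  rw [add_sub_cancel_left, mul_sum]
  refine sum_nonneg fun j hj => ?_
  rw [← mul_assoc]
  exact mul_nonneg (R_sign hδ m n j (by have := (Finset.mem_Ico.1 hj).1; omega)) (hpos _)

end PAlg

/-! ### Density of polynomials -/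

namespace PDens
open Polynomial

lemma pow_le_exp {c : ℝ} (hc : 0 < c) (k : ℕ) (x : ℝ) :
    |x| ^ k ≤ (k.factorial / c ^ k) * Real.exp (c * |x|) := by
  have h := Real.pow_div_factorial_le_exp (c * |x|) (by positivity) k
  rw [mul_pow, div_le_iff₀ (by positivity)] at h
  rw [div_mul_eq_mul_div, le_div_iff₀ (by positivity)]
  linarith

lemma poly_int {ν : Measure ℝ} {c : ℝ} (hc : 0 < c)
    (hexp : Integrable (fun x => Real.exp (c * |x|)) ν) (p : ℝ[X]) :
    Integrable (fun x => p.eval x) ν := by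
  induction p using Polynomial.induction_on' with
  | add p q hp hq => simp only [eval_add]; exact hp.add hq
  | monomial k a =>
    have : Integrable (fun x : ℝ => x ^ k) ν := by
      refine (hexp.const_mul (k.factorial / c ^ k)).mono' (by fun_prop) ?_
      refine Eventually.of_forall fun x => ?_
      rw [Real.norm_eq_abs, abs_pow]
      exact pow_le_exp hc k x
    simpa using this.const_mul a

lemma poly_memLp {ν : Measure ℝ} {c : ℝ} (hc : 0 < c)
    (hexp : Integrable (fun x => Real.exp (c * |x|)) ν) (p : ℝ[X]) :
    MemLp (fun x => p.eval x) 2 ν := by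
  rw [memLp_two_iff_integrable_sq (by fun_prop)]
  have := poly_int hc hexp (p ^ 2)
  simpa only [eval_pow] using this

lemma exp_set {ν : Measure ℝ} {c : ℝ}
    (hexp : Integrable (fun x => Real.exp (c * |x|)) ν) :
    Set.Ioo (-c) c ⊆ interior (integrableExpSet id ν) := by
  refine interior_maximal ?_ isOpen_Ioo
  intro t ht
  refine hexp.mono' (by fun_prop) (Eventually.of_forall fun x => ?_)
  rw [Real.norm_eq_abs, abs_of_pos (Real.exp_pos _)]
  apply Real.exp_le_exp.2
  have h1 : |t| ≤ c := abs_le.2 ⟨ht.1.le, ht.2.le⟩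
  calc t * id x ≤ |t * x| := le_abs_self _
    _ = |t| * |x| := abs_mul _ _
    _ ≤ c * |x| := by gcongr

lemma moment_det {ν₁ ν₂ : Measure ℝ} [IsFiniteMeasure ν₁] [IsFiniteMeasure ν₂] {c : ℝ} (hc : 0 < c)
    (h₁ : Integrable (fun x => Real.exp (c * |x|)) ν₁)
    (h₂ : Integrable (fun x => Real.exp (c * |x|)) ν₂)
    (hm : ∀ k : ℕ, ∫ x, x ^ k ∂ν₁ = ∫ x, x ^ k ∂ν₂) : ν₁ = ν₂ := by
  have h0 : (0 : ℂ).re ∈ Set.Ioo (-c) c := by simp [hc]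
  have a1 : AnalyticOnNhd ℂ (complexMGF id ν₁) {z | z.re ∈ Set.Ioo (-c) c} :=
    fun z hz => analyticAt_complexMGF (exp_set h₁ hz)
  have a2 : AnalyticOnNhd ℂ (complexMGF id ν₂) {z | z.re ∈ Set.Ioo (-c) c} :=
    fun z hz => analyticAt_complexMGF (exp_set h₂ hz)
  have hconv : IsPreconnected {z : ℂ | z.re ∈ Set.Ioo (-c) c} := by
    have : Convex ℝ {z : ℂ | z.re ∈ Set.Ioo (-c) c} :=
      (convex_halfSpace_re_gt (-c)).inter (convex_halfSpace_re_lt c)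
    exact this.isPreconnected
  have hev : complexMGF id ν₁ =ᶠ[nhds 0] complexMGF id ν₂ := by
    have b1 := (a1 0 h0).hasFPowerSeriesAt
    have b2 := (a2 0 h0).hasFPowerSeriesAt
    have : (fun n => iteratedDeriv n (complexMGF id ν₁) 0 / (n.factorial : ℂ)) =
        (fun n => iteratedDeriv n (complexMGF id ν₂) 0 / (n.factorial : ℂ)) := by
      funext n
      rw [iteratedDeriv_complexMGF (exp_set h₁ h0), iteratedDeriv_complexMGF (exp_set h₂ h0)]
      simp only [id, zero_mul, Complex.exp_zero, mul_one]
      have := congrArg (fun r : ℝ => (r : ℂ)) (hm n)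
      rw [← integral_complex_ofReal, ← integral_complex_ofReal] at this
      push_cast at this
      rw [this]
    rw [this] at b1
    have b3 := b1.sub b2
    rw [sub_self] at b3
    filter_upwards [b3.eventually_eq_zero] with z hz
    exact sub_eq_zero.1 hz
  have heq := a1.eqOn_of_preconnected_of_eventuallyEq a2 hconv h0 hev
  apply Measure.ext_of_charFun
  funext t
  rw [← complexMGF_id_mul_I, ← complexMGF_id_mul_I]
  exact heq (by simp [hc])

theorem poly_dense {ν : Measure ℝ} {c : ℝ} (hc : 0 < c)
    (hexp : Integrable (fun x => Real.exp (c * |x|)) ν) {h : ℝ → ℝ} (hh : MemLp h 2 ν)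
    {ε : ℝ} (hε : 0 < ε) : ∃ p : ℝ[X], ∫ x, (h x - p.eval x) ^ 2 ∂ν < ε := by
  have hfin : IsFiniteMeasure ν := by
    rw [← integrable_const_iff_isFiniteMeasure (c := (1 : ℝ)) one_ne_zero]
    refine hexp.mono' (by fun_prop) (Eventually.of_forall fun x => ?_)
    simp; positivity
  let Φ : ℝ[X] →ₗ[ℝ] Lp ℝ 2 ν :=
    { toFun := fun p => (poly_memLp hc hexp p).toLp _
      map_add' := fun p q => by
        rw [← MemLp.toLp_add]
        congr 1
        funext x; simp
      map_smul' := fun a p => by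
        rw [RingHom.id_apply, ← MemLp.toLp_const_smul]
        congr 1
        funext x; simp }
  have hΦ : ∀ p, (Φ p : ℝ → ℝ) =ᵐ[ν] fun x => p.eval x := fun p => MemLp.coeFn_toLp (poly_memLp hc hexp p)
  have htop : (LinearMap.range Φ).topologicalClosure = ⊤ := by
    rw [Submodule.topologicalClosure_eq_top_iff, Submodule.eq_bot_iff]
    intro u hu
    rw [Submodule.mem_orthogonal] at hu
    have hum : Measurable (u : ℝ → ℝ) := (Lp.stronglyMeasurable u).measurable
    have huL : MemLp (u : ℝ → ℝ) 2 ν := Lp.memLp u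
    have hui : Integrable (u : ℝ → ℝ) ν := huL.integrable (by norm_num)
    have hup : ∀ p : ℝ[X], ∫ x, p.eval x * u x ∂ν = 0 := by
      intro p
      have := hu (Φ p) ⟨p, rfl⟩
      rw [L2.inner_def] at this
      rw [← this]
      apply integral_congr_ae
      filter_upwards [hΦ p] with x hx
      rw [hx]; simp [mul_comm]
    have hupi : ∀ p : ℝ[X], Integrable (fun x => p.eval x * u x) ν := by
      intro p
      exact (poly_memLp hc hexp p).integrable_mul huL
    have hexp2 : Integrable (fun x => Real.exp (c / 2 * |x|) * u x) ν := by
      refine MemLp.integrable_mul (p := 2) ?_ huL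
      rw [memLp_two_iff_integrable_sq (by fun_prop)]
      refine hexp.congr (Eventually.of_forall fun x => ?_)
      simp only
      rw [← Real.exp_nat_mul]; congr 1; push_cast; ring
    set ν₁ := ν.withDensity (fun x => ENNReal.ofReal (u x)) with hν₁
    set ν₂ := ν.withDensity (fun x => ENNReal.ofReal (-u x)) with hν₂
    have m1 : Measurable (fun x => ENNReal.ofReal (u x)) := hum.ennreal_ofReal
    have m2 : Measurable (fun x => ENNReal.ofReal (-u x)) := hum.neg.ennreal_ofReal
    have f1 : IsFiniteMeasure ν₁ := isFiniteMeasure_withDensity_ofReal hui.2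
    have f2 : IsFiniteMeasure ν₂ := isFiniteMeasure_withDensity_ofReal hui.neg.2
    have key : ∀ F : ℝ → ℝ, Measurable F → Integrable (fun x => F x * u x) ν →
        Integrable F ν₁ ∧ Integrable F ν₂ ∧ ∫ x, F x * u x ∂ν = ∫ x, F x ∂ν₁ - ∫ x, F x ∂ν₂ := by
      intro F hF hFi
      have i1 : Integrable (fun x => (ENNReal.ofReal (u x)).toReal • F x) ν := by
        refine hFi.mono (by fun_prop) (Eventually.of_forall fun x => ?_)
        rw [smul_eq_mul, norm_mul, norm_mul, mul_comm]
        gcongr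
        rw [ENNReal.toReal_ofReal', Real.norm_eq_abs, Real.norm_eq_abs, abs_of_nonneg (le_max_right _ _)]
        exact max_le (le_abs_self _) (abs_nonneg _)
      have i2 : Integrable (fun x => (ENNReal.ofReal (-u x)).toReal • F x) ν := by
        refine hFi.mono (by fun_prop) (Eventually.of_forall fun x => ?_)
        rw [smul_eq_mul, norm_mul, norm_mul, mul_comm]
        gcongr
        rw [ENNReal.toReal_ofReal', Real.norm_eq_abs, Real.norm_eq_abs, abs_of_nonneg (le_max_right _ _)]
        exact max_le (neg_le_abs _) (abs_nonneg _)
      refine ⟨?_, ?_, ?_⟩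
      · rw [hν₁, integrable_withDensity_iff_integrable_smul' m1 (by simp)]; exact i1
      · rw [hν₂, integrable_withDensity_iff_integrable_smul' m2 (by simp)]; exact i2
      · rw [hν₁, hν₂, integral_withDensity_eq_integral_toReal_smul m1 (by simp),
          integral_withDensity_eq_integral_toReal_smul m2 (by simp), ← integral_sub i1 i2]
        congr 1
        funext x
        rw [ENNReal.toReal_ofReal', ENNReal.toReal_ofReal', smul_eq_mul, smul_eq_mul, ← sub_mul,
          max_zero_sub_eq_self, mul_comm]
    have heq : ν₁ = ν₂ := by
      obtain ⟨k1, k2, -⟩ := key _ (by fun_prop) hexp2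
      refine moment_det (half_pos hc) k1 k2 fun k => ?_
      obtain ⟨-, -, k3⟩ := key (fun x => x ^ k) (by fun_prop) (by simpa using hupi (X ^ k))
      have := hup (X ^ k)
      simp only [eval_pow, eval_X] at this
      rw [this] at k3
      linarith
    rw [hν₁, hν₂, withDensity_eq_iff m1.aemeasurable m2.aemeasurable] at heq
    · rw [Lp.eq_zero_iff_ae_eq_zero]
      filter_upwards [heq] with x hx
      simp only [Pi.zero_apply]
      rcases le_total 0 (u x) with h | h
      · rw [ENNReal.ofReal_of_nonpos (neg_nonpos.2 h), ENNReal.ofReal_eq_zero] at hx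
        exact le_antisymm hx h
      · rw [ENNReal.ofReal_of_nonpos h, eq_comm, ENNReal.ofReal_eq_zero] at hx
        linarith
    · have := f1.measure_univ_lt_top
      rw [hν₁, withDensity_apply _ MeasurableSet.univ, Measure.restrict_univ] at this
      exact this.ne
  have hmem : hh.toLp h ∈ (LinearMap.range Φ).topologicalClosure := by rw [htop]; trivial
  have hmem' : hh.toLp h ∈ closure ((LinearMap.range Φ : Submodule ℝ (Lp ℝ 2 ν)) : Set (Lp ℝ 2 ν)) := hmem
  rw [Metric.mem_closure_iff] at hmem'
  obtain ⟨b, ⟨p, rfl⟩, hb⟩ := hmem' (Real.sqrt ε) (Real.sqrt_pos.2 hε)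
  refine ⟨p, ?_⟩
  rw [dist_eq_norm] at hb
  have h2 : ‖hh.toLp h - Φ p‖ ^ 2 = ∫ x, (h x - p.eval x) ^ 2 ∂ν := by
    rw [← real_inner_self_eq_norm_sq, L2.inner_def]
    apply integral_congr_ae
    filter_upwards [Lp.coeFn_sub (hh.toLp h) (Φ p), hΦ p, hh.coeFn_toLp] with x h1 h2 h3
    rw [h1, Pi.sub_apply, h2, h3]
    simp [sq]
  rw [← h2]
  calc ‖hh.toLp h - Φ p‖ ^ 2 < Real.sqrt ε ^ 2 := by gcongr
    _ = ε := Real.sq_sqrt hε.le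

end PDens

/-! ### Absolutely continuous functions and Pearson weights -/

namespace PW
open Polynomial
open scoped Interval

/-- `h` is locally absolutely continuous on `J` with derivative `ψ`. -/
structure AC (J : Set ℝ) (h ψ : ℝ → ℝ) : Prop where
  mh : Measurable h
  mψ : Measurable ψ
  ii : ∀ a ∈ J, ∀ b ∈ J, IntervalIntegrable ψ volume a b
  ftc : ∀ a ∈ J, ∀ b ∈ J, h b - h a = ∫ t in a..b, ψ t

lemma AC.sub {J : Set ℝ} {h ψ k φ : ℝ → ℝ} (A : AC J h ψ) (B : AC J k φ) :
    AC J (fun x => h x - k x) (fun x => ψ x - φ x) where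
  mh := A.mh.sub B.mh
  mψ := A.mψ.sub B.mψ
  ii := fun a ha b hb => (A.ii a ha b hb).sub (B.ii a ha b hb)
  ftc := fun a ha b hb => by
    rw [intervalIntegral.integral_sub (A.ii a ha b hb) (B.ii a ha b hb), ← A.ftc a ha b hb,
      ← B.ftc a ha b hb]
    ring

lemma AC.poly (J : Set ℝ) (p : ℝ[X]) :
    AC J (fun x => p.eval x) (fun x => (derivative p).eval x) where
  mh := by fun_prop
  mψ := by fun_prop
  ii := fun a _ b _ => (by fun_prop : Continuous fun x => (derivative p).eval x).intervalIntegrable _ _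
  ftc := fun a _ b _ => by
    rw [intervalIntegral.integral_eq_sub_of_hasDerivAt (f := fun x => p.eval x)]
    · intro x _
      exact p.hasDerivAt x
    · exact (by fun_prop : Continuous fun x => (derivative p).eval x).intervalIntegrable _ _

lemma AC.aci {J : Set ℝ} (hJ : J.OrdConnected) {h ψ : ℝ → ℝ} (A : AC J h ψ) {a b : ℝ}
    (ha : a ∈ J) (hb : b ∈ J) :
    AbsolutelyContinuousOnInterval (fun x => h a + ∫ t in a..x, ψ t) a b ∧
      (∀ x ∈ [[a, b]], h x = h a + ∫ t in a..x, ψ t) := by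
  constructor
  · have h1 := (A.ii a ha b hb).absolutelyContinuousOnInterval_intervalIntegral
      (c := a) (by simp)
    have h2 : AbsolutelyContinuousOnInterval (fun _ : ℝ => h a) a b :=
      (contDiff_const.contDiffOn).absolutelyContinuousOnInterval
    exact h2.add h1
  · intro x hx
    have hxJ : x ∈ J := hJ.uIcc_subset ha hb hx
    rw [← A.ftc a ha x hxJ]; ring

lemma AC.contOn {J : Set ℝ} (hJ : J.OrdConnected) {h ψ : ℝ → ℝ} (A : AC J h ψ) {a b : ℝ}
    (ha : a ∈ J) (hb : b ∈ J) : ContinuousOn h [[a, b]] := by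
  obtain ⟨h1, h2⟩ := A.aci hJ ha hb
  exact h1.continuousOn.congr h2

lemma AC.mul_poly {J : Set ℝ} (hJ : J.OrdConnected) {h ψ : ℝ → ℝ} (A : AC J h ψ) (r : ℝ[X]) :
    AC J (fun x => h x * r.eval x)
      (fun x => ψ x * r.eval x + h x * (derivative r).eval x) where
  mh := A.mh.mul (by fun_prop)
  mψ := (A.mψ.mul (by fun_prop)).add (A.mh.mul (by fun_prop))
  ii := fun a ha b hb => by
    refine ((A.ii a ha b hb).mul_continuousOn (by fun_prop)).add ?_
    exact ((A.contOn hJ ha hb).mul (by fun_prop)).intervalIntegrable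
  ftc := fun a ha b hb => by
    obtain ⟨h1, h2⟩ := A.aci hJ ha hb
    have hr : AbsolutelyContinuousOnInterval (fun x => r.eval x) a b :=
      ((by simpa using r.contDiff_aeval (𝕜 := ℝ) 1 : ContDiff ℝ 1 fun x => r.eval x).contDiffOn).absolutelyContinuousOnInterval
    have := h1.integral_deriv_mul_eq_sub hr
    have e1 := h2 b (by simp)
    have e2 := h2 a (by simp)
    rw [← e1, ← e2] at this
    rw [← this]
    apply intervalIntegral.integral_congr_ae
    filter_upwards [(A.ii a ha b hb).ae_hasDerivAt_integral] with x hx hx2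
    have hx3 : x ∈ [[a, b]] := Set.uIoc_subset_uIcc hx2
    have h4 := ((hx hx3 a (by simp)).const_add (h a)).deriv
    rw [h4, ← h2 x hx3, Polynomial.deriv]

/-- Pearson weight: the derivative of `q w` is `(b - a x) w`, in integrated form. -/
structure Wt (J : Set ℝ) (δ β γ a b : ℝ) (w : ℝ → ℝ) : Prop where
  op : IsOpen J
  oc : J.OrdConnected
  ne : J.Nonempty
  qpos : ∀ x ∈ J, 0 < pq δ β γ x
  hδ : δ ≤ 0
  ha : 0 < a
  meas : Measurable w
  pos : ∀ x ∈ J, 0 < w x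
  off : ∀ x, x ∉ J → w x = 0
  int : Integrable w
  intx : Integrable (fun x => x * w x)
  right : ∀ t, ∫ x in Set.Ioi t, (a * x - b) * w x = pq δ β γ t * w t
  total : ∫ x, (a * x - b) * w x = 0

variable {J : Set ℝ} {δ β γ a b : ℝ} {w : ℝ → ℝ}

namespace Wt

lemma nonneg (W : Wt J δ β γ a b w) (x : ℝ) : 0 ≤ w x := by
  by_cases hx : x ∈ J
  · exact (W.pos x hx).le
  · exact (W.off x hx).ge

lemma intl (W : Wt J δ β γ a b w) : Integrable (fun x => (a * x - b) * w x) := by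
  have := (W.intx.const_mul a).sub (W.int.const_mul b)
  refine this.congr (Eventually.of_forall fun x => ?_)
  simp only [Pi.sub_apply]; ring

lemma left (W : Wt J δ β γ a b w) (t : ℝ) :
    ∫ x in Set.Iic t, (b - a * x) * w x = pq δ β γ t * w t := by
  have h1 := intervalIntegral.integral_Iic_add_Ioi (b := t) W.intl.integrableOn W.intl.integrableOn
  rw [W.total, W.right] at h1
  have h2 : ∫ x in Set.Iic t, (b - a * x) * w x = - ∫ x in Set.Iic t, (a * x - b) * w x := by
    rw [← integral_neg]; congr 1; funext x; ring
  linarith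

lemma qw_nonneg (W : Wt J δ β γ a b w) (x : ℝ) : 0 ≤ pq δ β γ x * w x := by
  by_cases hx : x ∈ J
  · exact (mul_pos (W.qpos x hx) (W.pos x hx)).le
  · simp [W.off x hx]

lemma pos_of (W : Wt J δ β γ a b w) {k : ℝ → ℝ} (hk : Integrable (fun x => k x * w x))
    (hp : ∀ x ∈ J, 0 < k x) : 0 < ∫ x, k x * w x := by
  rw [integral_pos_iff_support_of_nonneg _ hk]
  · refine lt_of_lt_of_le (W.op.measure_pos volume W.ne) (measure_mono fun x hx => ?_)
    exact (mul_pos (hp x hx) (W.pos x hx)).ne'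
  · intro x
    by_cases hx : x ∈ J
    · exact (mul_pos (hp x hx) (W.pos x hx)).le
    · simp [W.off x hx]

lemma ctr (W : Wt J δ β γ a b w) : b / a ∈ J := by
  by_contra hc
  obtain ⟨y, hy⟩ := W.ne
  have ha := W.ha
  rcases lt_or_ge y (b / a) with hlt | hge
  · have : ∀ x ∈ J, 0 < -(a * x - b) := by
      intro x hx
      have : x < b / a := by
        by_contra hx2
        exact hc (W.oc.out hy hx ⟨hlt.le, not_lt.1 hx2⟩)
      rw [lt_div_iff₀ ha] at this
      linarith
    have h := W.pos_of (k := fun x => -(a * x - b)) ?_ this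
    · simp only [neg_mul, integral_neg, W.total] at h; simp at h
    · simp only [neg_mul]; exact W.intl.neg
  · have : ∀ x ∈ J, 0 < (a * x - b) := by
      intro x hx
      have : b / a < x := by
        by_contra hx2
        exact hc (W.oc.out hx hy ⟨not_lt.1 hx2, hge⟩)
      rw [div_lt_iff₀ ha] at this
      linarith
    have h := W.pos_of (k := fun x => (a * x - b)) W.intl this
    rw [W.total] at h; simp at h

/-- The kernel of the covariance representation. -/
def ker (a b : ℝ) (w : ℝ → ℝ) (x s : ℝ) : ℝ :=
  {p : ℝ × ℝ | p.2 ∈ Ι (b / a) p.1}.indicator (fun p => |a * p.1 - b| * w p.1) (x, s)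

lemma ker_of_mem {x s : ℝ} (h : s ∈ Ι (b / a) x) : ker a b w x s = |a * x - b| * w x :=
  Set.indicator_of_mem (s := {p : ℝ × ℝ | p.2 ∈ Ι (b / a) p.1}) h _

lemma ker_of_notMem {x s : ℝ} (h : s ∉ Ι (b / a) x) : ker a b w x s = 0 :=
  Set.indicator_of_notMem (s := {p : ℝ × ℝ | p.2 ∈ Ι (b / a) p.1}) h _

lemma ker_meas (W : Wt J δ β γ a b w) : Measurable (fun p : ℝ × ℝ => ker a b w p.1 p.2) := by
  have hm := W.meas
  refine Measurable.indicator (by fun_prop) ?_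
  have : {p : ℝ × ℝ | p.2 ∈ Ι (b / a) p.1} =
      {p : ℝ × ℝ | min (b / a) p.1 < p.2} ∩ {p : ℝ × ℝ | p.2 ≤ max (b / a) p.1} := by
    ext p; simp [Set.uIoc]
  rw [this]
  exact (measurableSet_lt (by fun_prop) (by fun_prop)).inter
    (measurableSet_le (by fun_prop) (by fun_prop))

lemma ker_nonneg (W : Wt J δ β γ a b w) (x s : ℝ) : 0 ≤ ker a b w x s :=
  Set.indicator_nonneg (fun _ _ => mul_nonneg (abs_nonneg _) (W.nonneg _)) _

lemma ker_int (W : Wt J δ β γ a b w) (s : ℝ) :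
    Integrable (fun x => ker a b w x s) ∧ ∫ x, ker a b w x s = pq δ β γ s * w s := by
  have ha := W.ha
  rcases lt_or_ge (b / a) s with hs | hs
  · have h1 : (fun x => ker a b w x s) =
        (Set.Ici s).indicator (fun x => (a * x - b) * w x) := by
      funext x
      by_cases hx : s ≤ x
      · rw [Set.indicator_of_mem (by simpa using hx), ker_of_mem]
        · rw [abs_of_pos]
          have := hs.trans_le hx
          rw [div_lt_iff₀ ha] at this
          linarith
        · rw [Set.mem_uIoc]; exact Or.inl ⟨hs, hx⟩
      · rw [Set.indicator_of_notMem (by simpa using hx), ker_of_notMem]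
        rw [Set.mem_uIoc]
        rintro (⟨_, h⟩ | ⟨_, h⟩)
        · exact hx h
        · linarith
    rw [h1]
    refine ⟨W.intl.indicator measurableSet_Ici, ?_⟩
    rw [integral_indicator measurableSet_Ici, integral_Ici_eq_integral_Ioi, W.right]
  · have h1 : (fun x => ker a b w x s) =
        (Set.Iio s).indicator (fun x => (b - a * x) * w x) := by
      funext x
      by_cases hx : x < s
      · rw [Set.indicator_of_mem (by simpa using hx), ker_of_mem]
        · rw [abs_of_neg, neg_sub]
          have := hx.trans_le hs
          rw [lt_div_iff₀ ha] at this
          linarith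
        · rw [Set.mem_uIoc]; exact Or.inr ⟨hx, hs⟩
      · rw [Set.indicator_of_notMem (by simpa using hx), ker_of_notMem]
        rw [Set.mem_uIoc]
        rintro (⟨h, _⟩ | ⟨h, _⟩)
        · linarith
        · exact hx h
    rw [h1]
    refine ⟨?_, ?_⟩
    · refine Integrable.indicator ?_ measurableSet_Iio
      have := W.intl.neg
      refine this.congr (Eventually.of_forall fun x => ?_)
      simp only [Pi.neg_apply]; ring
    · rw [integral_indicator measurableSet_Iio, ← integral_Iic_eq_integral_Iio, W.left]

lemma ker_set (x : ℝ) (ψ : ℝ → ℝ) :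
    (fun s => ker a b w x s * ψ s) =
      (Ι (b / a) x).indicator (fun s => |a * x - b| * w x * ψ s) := by
  funext s
  by_cases hs : s ∈ Ι (b / a) x
  · rw [Set.indicator_of_mem hs, ker_of_mem hs]
  · rw [Set.indicator_of_notMem hs, ker_of_notMem hs, zero_mul]

lemma fub (W : Wt J δ β γ a b w) {ψ : ℝ → ℝ} (hψ : Measurable ψ)
    (hi : Integrable (fun s => pq δ β γ s * w s * ψ s)) :
    Integrable (fun x => |a * x - b| * w x * ∫ s in Ι (b / a) x, ψ s) ∧
    ∫ x, |a * x - b| * w x * ∫ s in Ι (b / a) x, ψ s = ∫ s, pq δ β γ s * w s * ψ s ∧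
    ∀ᵐ x, x ≠ b / a → x ∈ J → IntegrableOn ψ (Ι (b / a) x) := by
  have hG : Integrable (fun p : ℝ × ℝ => ker a b w p.1 p.2 * ψ p.2) (volume.prod volume) := by
    have hmm : Measurable (fun p : ℝ × ℝ => ker a b w p.1 p.2 * ψ p.2) :=
      W.ker_meas.mul (hψ.comp measurable_snd)
    rw [integrable_prod_iff' hmm.aestronglyMeasurable]
    refine ⟨Eventually.of_forall fun s => (W.ker_int s).1.mul_const (ψ s), ?_⟩
    refine hi.norm.congr (Eventually.of_forall fun s => ?_)
    simp only [norm_mul]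
    rw [integral_mul_const]
    have : ∫ x, ‖ker a b w x s‖ = pq δ β γ s * w s := by
      rw [← (W.ker_int s).2]
      congr 1; funext x
      exact Real.norm_of_nonneg (W.ker_nonneg x s)
    rw [this, ← norm_mul, Real.norm_of_nonneg (W.qw_nonneg s)]
  have hin : ∀ x, ∫ s, ker a b w x s * ψ s = |a * x - b| * w x * ∫ s in Ι (b / a) x, ψ s := by
    intro x
    rw [ker_set, integral_indicator measurableSet_uIoc, integral_const_mul]
  refine ⟨?_, ?_, ?_⟩
  · refine hG.integral_prod_left.congr (Eventually.of_forall fun x => hin x)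
  · simp_rw [← hin]
    rw [integral_integral_swap hG]
    congr 1; funext s
    rw [integral_mul_const, (W.ker_int s).2]
  · filter_upwards [hG.prod_right_ae] with x hx hne hxJ
    rw [ker_set, integrable_indicator_iff measurableSet_uIoc] at hx
    have hk : |a * x - b| * w x ≠ 0 := by
      refine mul_ne_zero (abs_ne_zero.2 fun h => hne ?_) (W.pos x hxJ).ne'
      rw [eq_div_iff W.ha.ne']; linarith
    have := hx.const_mul (|a * x - b| * w x)⁻¹
    refine this.congr (Eventually.of_forall fun s => ?_)
    exact inv_mul_cancel_left₀ hk _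

end Wt
end PW

namespace PW
open Polynomial
open scoped Interval

lemma cs_restrict {s : Set ℝ} {L : ℝ} (hL : 0 < L) (hs : volume s = ENNReal.ofReal L)
    {ψ : ℝ → ℝ} (h1 : IntegrableOn ψ s) (h2 : IntegrableOn (fun x => ψ x ^ 2) s) :
    (∫ x in s, ψ x) ^ 2 ≤ L * ∫ x in s, ψ x ^ 2 := by
  have hfin : IsFiniteMeasure (volume.restrict s) := ⟨by simp [hs]⟩
  set S := ∫ x in s, ψ x with hS
  have h3 : 0 ≤ ∫ x in s, (L * ψ x - S) ^ 2 := integral_nonneg fun x => sq_nonneg _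
  have h4 : ∫ x in s, (L * ψ x - S) ^ 2 = L ^ 2 * (∫ x in s, ψ x ^ 2) - 2 * L * S * S + S ^ 2 * L := by
    have e : ∀ x, (L * ψ x - S) ^ 2 = (L ^ 2 * ψ x ^ 2 - 2 * L * S * ψ x) + S ^ 2 := by
      intro x; ring
    simp_rw [e]
    have i3 : Integrable (fun x => L ^ 2 * ψ x ^ 2 - 2 * L * S * ψ x) (volume.restrict s) :=
      (h2.const_mul _).sub (h1.const_mul _)
    rw [integral_add i3 (integrable_const _),
      integral_sub (h2.const_mul _) (h1.const_mul _), integral_const_mul, integral_const_mul,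
      integral_const, ← hS]
    simp [Measure.real, hs, hL.le]
    ring
  rw [h4] at h3
  have h5 : 0 ≤ L * (L * (∫ x in s, ψ x ^ 2) - S ^ 2) := by nlinarith
  have := nonneg_of_mul_nonneg_right h5 hL
  linarith

variable {J : Set ℝ} {δ β γ a b : ℝ} {w : ℝ → ℝ}

namespace Wt

lemma ax (W : Wt J δ β γ a b w) (x : ℝ) : a * x - b = a * (x - b / a) := by
  have := W.ha.ne'
  field_simp

lemma key (W : Wt J δ β γ a b w) {h ψ : ℝ → ℝ} (A : AC J h ψ) (x : ℝ) :
    (a * x - b) * w x * (h x - h (b / a)) = |a * x - b| * w x * ∫ s in Ι (b / a) x, ψ s := by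
  by_cases hx : x ∈ J
  · rw [A.ftc _ W.ctr _ hx, W.ax, abs_mul, abs_of_pos W.ha]
    rcases le_total (b / a) x with h1 | h1
    · rw [Set.uIoc_of_le h1, intervalIntegral.integral_of_le h1, abs_of_nonneg (by linarith)]
    · rw [Set.uIoc_of_ge h1, intervalIntegral.integral_of_ge h1, abs_of_nonpos (by linarith)]
      ring
  · simp [W.off x hx]

lemma stein1 (W : Wt J δ β γ a b w) {h ψ : ℝ → ℝ} (A : AC J h ψ)
    (hi : Integrable (fun s => pq δ β γ s * w s * ψ s)) :
    Integrable (fun x => (a * x - b) * w x * h x) ∧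
    ∫ x, (a * x - b) * w x * h x = ∫ s, pq δ β γ s * w s * ψ s := by
  obtain ⟨f1, f2, -⟩ := W.fub A.mψ hi
  have e : ∀ x, (a * x - b) * w x * h x =
      |a * x - b| * w x * (∫ s in Ι (b / a) x, ψ s) + (a * x - b) * w x * h (b / a) := by
    intro x; rw [← W.key A]; ring
  simp_rw [e]
  refine ⟨f1.add (W.intl.mul_const _), ?_⟩
  rw [integral_add f1 (W.intl.mul_const _), f2, integral_mul_const, W.total]
  simp

lemma stein2 (W : Wt J δ β γ a b w) {h ψ : ℝ → ℝ} (A : AC J h ψ)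
    (hi : Integrable (fun s => pq δ β γ s * w s * ψ s)) :
    Integrable (fun x => w x * h x) := by
  have ha := W.ha
  have h1 := (W.stein1 A hi).1
  obtain ⟨ε, hε, hsub⟩ := Metric.isOpen_iff.1 W.op _ W.ctr
  set c := b / a with hc
  have hl : c - ε / 2 ∈ J := hsub (by rw [Metric.mem_ball, Real.dist_eq]; rw [abs_lt]; constructor <;> linarith)
  have hr : c + ε / 2 ∈ J := hsub (by rw [Metric.mem_ball, Real.dist_eq]; rw [abs_lt]; constructor <;> linarith)
  have hcont := A.contOn W.oc hl hr
  obtain ⟨M, hM⟩ := isCompact_uIcc.exists_bound_of_continuousOn hcont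
  have hM0 : 0 ≤ M := (norm_nonneg _).trans (hM _ Set.left_mem_uIcc)
  have hmw := W.meas
  have hmh := A.mh
  refine ((W.int.const_mul M).add (h1.norm.const_mul (2 / (a * ε)))).mono'
    (by fun_prop) (Eventually.of_forall fun x => ?_)
  simp only [Pi.add_apply, norm_mul, Real.norm_eq_abs]
  rw [abs_of_nonneg (W.nonneg x)]
  have hw := W.nonneg x
  by_cases hx : |x - c| ≤ ε / 2
  · have : |h x| ≤ M := hM x (by
      rw [Set.uIcc_of_le (by linarith)]
      rw [abs_le] at hx
      constructor <;> linarith)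
    have h2 : 0 ≤ 2 / (a * ε) * (|a * x - b| * w x * |h x|) := by positivity
    nlinarith
  · rw [W.ax, abs_mul, abs_of_pos ha]
    have h2 : 1 ≤ 2 / (a * ε) * (a * |x - c|) := by
      rw [div_mul_eq_mul_div, le_div_iff₀ (by positivity)]
      nlinarith
    have h3 : 0 ≤ w x * |h x| := by positivity
    have h4 : 0 ≤ M * w x := by positivity
    nlinarith

lemma poincare (W : Wt J δ β γ a b w) {h ψ : ℝ → ℝ} (A : AC J h ψ)
    (hi : Integrable (fun s => pq δ β γ s * w s * ψ s ^ 2)) :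
    Integrable (fun x => w x * (h x - h (b / a)) ^ 2) ∧
    a * ∫ x, w x * (h x - h (b / a)) ^ 2 ≤ ∫ s, pq δ β γ s * w s * ψ s ^ 2 := by
  have ha := W.ha
  have hmw := W.meas
  have hmh := A.mh
  obtain ⟨f1, f2, f3⟩ := W.fub (A.mψ.pow_const 2) hi
  have hp : ∀ᵐ x, a * (w x * (h x - h (b / a)) ^ 2) ≤
      |a * x - b| * w x * ∫ s in Ι (b / a) x, ψ s ^ 2 := by
    filter_upwards [f3] with x hx
    by_cases hxJ : x ∈ J
    · by_cases hxc : x = b / a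
      · rw [hxc]; simp
      · have i2 := hx hxc hxJ
        have i1 := (A.ii _ W.ctr _ hxJ).def'
        have hL : 0 < |x - b / a| := abs_pos.2 (sub_ne_zero.2 hxc)
        have hcs := cs_restrict hL (s := Ι (b / a) x) (by rw [Real.volume_uIoc]) i1 i2
        have : (h x - h (b / a)) ^ 2 = (∫ s in Ι (b / a) x, ψ s) ^ 2 := by
          rw [A.ftc _ W.ctr _ hxJ, ← sq_abs, ← sq_abs (∫ s in Ι (b / a) x, ψ s),
            intervalIntegral.abs_integral_eq_abs_integral_uIoc]
        rw [this, W.ax, abs_mul, abs_of_pos ha]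
        have hw := W.nonneg x
        calc a * (w x * (∫ s in Ι (b / a) x, ψ s) ^ 2)
            ≤ a * (w x * (|x - b / a| * ∫ s in Ι (b / a) x, ψ s ^ 2)) := by gcongr
          _ = _ := by ring
    · simp [W.off x hxJ]
  have h0 : ∀ x, 0 ≤ a * (w x * (h x - h (b / a)) ^ 2) := fun x =>
    mul_nonneg ha.le (mul_nonneg (W.nonneg x) (sq_nonneg _))
  have hI : Integrable (fun x => a * (w x * (h x - h (b / a)) ^ 2)) := by
    refine f1.mono' (by fun_prop) ?_
    filter_upwards [hp] with x hx
    rw [Real.norm_of_nonneg (h0 x)]; exact hx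
  constructor
  · have := hI.const_mul a⁻¹
    refine this.congr (Eventually.of_forall fun x => ?_)
    exact inv_mul_cancel_left₀ ha.ne' _
  · rw [← integral_const_mul, ← f2]
    exact integral_mono_ae hI f1 hp

lemma q_bound (W : Wt J δ β γ a b w) (x : ℝ) :
    |pq δ β γ x| * w x ≤ (|β| + |γ|) * (1 + |x|) * w x := by
  by_cases hx : x ∈ J
  · rw [abs_of_pos (W.qpos x hx)]
    refine mul_le_mul_of_nonneg_right ?_ (W.nonneg x)
    unfold pq
    have h1 : δ * x ^ 2 ≤ 0 := mul_nonpos_of_nonpos_of_nonneg W.hδ (sq_nonneg x)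
    have h2 : β * x ≤ |β| * |x| := by rw [← abs_mul]; exact le_abs_self _
    have h3 := le_abs_self γ
    have h4 := mul_nonneg (abs_nonneg γ) (abs_nonneg x)
    have h5 := abs_nonneg β
    nlinarith
  · simp [W.off x hx]

lemma pq_meas : Measurable (pq δ β γ) := by unfold pq; fun_prop

lemma int_q (W : Wt J δ β γ a b w) {k : ℝ → ℝ} (hk : Measurable k)
    (h0 : Integrable (fun x => w x * k x)) (h1 : Integrable (fun x => w x * (k x * x))) :
    Integrable (fun x => pq δ β γ x * w x * k x) := by
  have hmw := W.meas
  have hq : Measurable (pq δ β γ) := pq_meas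
  refine ((h0.norm.const_mul (|β| + |γ|)).add (h1.norm.const_mul (|β| + |γ|))).mono'
    (by fun_prop) (Eventually.of_forall fun x => ?_)
  simp only [Pi.add_apply, norm_mul, Real.norm_eq_abs]
  have hw := W.nonneg x
  rw [abs_of_nonneg hw]
  have := mul_le_mul_of_nonneg_right (W.q_bound x) (abs_nonneg (k x))
  nlinarith

/-- Exponential moments. -/
def Ex (w : ℝ → ℝ) : Prop := ∃ η : ℝ, 0 < η ∧ Integrable (fun x => Real.exp (η * |x|) * w x)

lemma exp_primitive {η : ℝ} (hη : 0 < η) (c x : ℝ) :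
    ∫ s in Ι c x, η * Real.exp (η * |s - c|) = Real.exp (η * |x - c|) - 1 := by
  rcases le_total c x with h | h
  · rw [Set.uIoc_of_le h, abs_of_nonneg (sub_nonneg.2 h)]
    have e : ∫ s in Set.Ioc c x, η * Real.exp (η * |s - c|) =
        ∫ s in Set.Ioc c x, η * Real.exp (η * (s - c)) := by
      refine setIntegral_congr_fun measurableSet_Ioc fun s hs => ?_
      rw [abs_of_nonneg (by linarith [hs.1])]
    rw [e, ← intervalIntegral.integral_of_le h,
      intervalIntegral.integral_eq_sub_of_hasDerivAt (f := fun s => Real.exp (η * (s - c)))]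
    · simp
    · intro s _
      have : HasDerivAt (fun s => η * (s - c)) η s := by
        simpa using ((hasDerivAt_id s).sub_const c).const_mul η
      simpa [mul_comm] using this.exp
    · exact (by fun_prop : Continuous fun s => η * Real.exp (η * (s - c))).intervalIntegrable _ _
  · rw [Set.uIoc_of_ge h, abs_of_nonpos (sub_nonpos.2 h)]
    have e : ∫ s in Set.Ioc x c, η * Real.exp (η * |s - c|) =
        ∫ s in Set.Ioc x c, η * Real.exp (η * (-(s - c))) := by
      refine setIntegral_congr_fun measurableSet_Ioc fun s hs => ?_
      rw [abs_of_nonpos (by linarith [hs.2])]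
    rw [e, ← intervalIntegral.integral_of_le h,
      intervalIntegral.integral_eq_sub_of_hasDerivAt (f := fun s => -Real.exp (η * (-(s - c))))]
    · simp; ring
    · intro s _
      have : HasDerivAt (fun s => η * (-(s - c))) (-η) s := by
        simpa using ((hasDerivAt_id s).sub_const c).neg.const_mul η
      simpa [mul_comm] using this.exp.fun_neg
    · exact (by fun_prop : Continuous fun s => η * Real.exp (η * (-(s - c)))).intervalIntegrable _ _

lemma exp_bound (W : Wt J δ β γ a b w) {C η N : ℝ} (hη : 0 < η) (hηC : η * C = a / 4)
    (hC : ∀ x, pq δ β γ x * w x ≤ C * (1 + |x - b / a|) * w x) :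
    ∫ x in Metric.ball (b / a) N, |x - b / a| * Real.exp (η * |x - b / a|) * w x ≤
      2 * (∫ x, |x - b / a| * w x) + 1 / 2 * (Real.exp η * ∫ x, w x) := by
  have ha := W.ha
  have hmw := W.meas
  have hmq : Measurable (pq δ β γ) := pq_meas
  set c := b / a with hc
  have iy : Integrable (fun x => |x - c| * w x) := by
    have := (W.intx.sub (W.int.const_mul c)).norm
    refine this.congr (Eventually.of_forall fun x => ?_)
    simp only [Pi.sub_apply]
    rw [← sub_mul, norm_mul, Real.norm_eq_abs, Real.norm_of_nonneg (W.nonneg x)]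
  set e : ℝ → ℝ := (Metric.ball c N).indicator (fun x => Real.exp (η * |x - c|)) with he
  have hme : Measurable e := Measurable.indicator (by fun_prop) measurableSet_ball
  have e0 : ∀ x, 0 ≤ e x := fun x => Set.indicator_nonneg (fun _ _ => (Real.exp_pos _).le) _
  have eB : ∀ x, e x ≤ Real.exp (η * N) := by
    intro x
    by_cases hx : x ∈ Metric.ball c N
    · rw [he, Set.indicator_of_mem hx]
      rw [Metric.mem_ball, Real.dist_eq] at hx
      apply Real.exp_le_exp.2; gcongr
    · rw [he, Set.indicator_of_notMem hx]; positivity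
  have bnd : ∀ k : ℝ → ℝ, Measurable k → Integrable k → Integrable (fun x => k x * e x) := by
    intro k hk hki
    refine (hki.norm.mul_const (Real.exp (η * N))).mono' (by fun_prop)
      (Eventually.of_forall fun x => ?_)
    rw [norm_mul, Real.norm_of_nonneg (e0 x)]
    have := eB x
    gcongr
  have iq : Integrable (fun x => pq δ β γ x * w x) := by
    have := W.int_q (k := fun _ => 1) (by fun_prop) (by simpa using W.int)
      (by simpa [mul_comm] using W.intx)
    simpa using this
  have iψ : Integrable (fun s => pq δ β γ s * w s * (η * e s)) := by
    have := (bnd _ (by fun_prop) iq).const_mul η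
    refine this.congr (Eventually.of_forall fun x => ?_)
    simp only; ring
  obtain ⟨f1, f2, -⟩ := W.fub (ψ := fun s => η * e s) (by fun_prop) iψ
  have iye := bnd _ (by fun_prop) iy
  have iwe := bnd _ (by fun_prop) W.int
  have L : ∫ x, (a * (|x - c| * w x * e x) - a * (|x - c| * w x)) ≤
      ∫ x, |a * x - b| * w x * ∫ s in Ι c x, η * e s := by
    refine integral_mono ((iye.const_mul a).sub (iy.const_mul a)) f1 fun x => ?_
    simp only
    rw [W.ax, abs_mul, abs_of_pos ha]
    have : e x - 1 ≤ ∫ s in Ι c x, η * e s := by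
      by_cases hx : x ∈ Metric.ball c N
      · have h1 : ∫ s in Ι c x, η * e s = ∫ s in Ι c x, η * Real.exp (η * |s - c|) := by
          refine setIntegral_congr_fun measurableSet_uIoc fun s hs => ?_
          have : s ∈ Metric.ball c N := by
            rw [Metric.mem_ball, Real.dist_eq] at hx ⊢
            rw [Set.mem_uIoc] at hs
            rw [abs_lt] at hx ⊢
            rcases hs with hs | hs <;> constructor <;> linarith
          simp only [he]
          rw [Set.indicator_of_mem this]
        rw [h1, exp_primitive hη, he, Set.indicator_of_mem hx]
      · have h1 : e x = 0 := by rw [he, Set.indicator_of_notMem hx]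
        have h2 : 0 ≤ ∫ s in Ι c x, η * e s := integral_nonneg fun s => mul_nonneg hη.le (e0 s)
        linarith
    have h3 : 0 ≤ a * |x - c| * w x := by have := W.nonneg x; positivity
    have := mul_le_mul_of_nonneg_left this h3
    linarith
  have R : ∫ s, pq δ β γ s * w s * (η * e s) ≤
      ∫ x, (a / 4 * Real.exp η * w x + a / 2 * (|x - c| * w x * e x)) := by
    refine integral_mono iψ ((W.int.const_mul _).add (iye.const_mul _)) fun x => ?_
    simp only
    have hw := W.nonneg x
    have h1 : e x ≤ Real.exp η + |x - c| * e x := by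
      by_cases hx : |x - c| ≤ 1
      · have : e x ≤ Real.exp η := by
          by_cases hx2 : x ∈ Metric.ball c N
          · rw [he, Set.indicator_of_mem hx2]
            apply Real.exp_le_exp.2; nlinarith
          · rw [he, Set.indicator_of_notMem hx2]; positivity
        have := mul_nonneg (abs_nonneg (x - c)) (e0 x)
        linarith
      · have := Real.exp_pos η
        have := e0 x
        nlinarith
    calc pq δ β γ x * w x * (η * e x) ≤ C * (1 + |x - c|) * w x * (η * e x) := by
          refine mul_le_mul_of_nonneg_right (hC x) (mul_nonneg hη.le (e0 x))
      _ = a / 4 * (1 + |x - c|) * w x * e x := by rw [← hηC]; ring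
      _ = a / 4 * w x * e x + a / 4 * (|x - c| * w x * e x) := by ring
      _ ≤ a / 4 * w x * (Real.exp η + |x - c| * e x) + a / 4 * (|x - c| * w x * e x) := by gcongr
      _ = _ := by ring
  rw [integral_sub (iye.const_mul a) (iy.const_mul a), integral_const_mul, integral_const_mul, f2] at L
  rw [integral_add (W.int.const_mul _) (iye.const_mul _), integral_const_mul, integral_const_mul] at R
  have fin : ∫ x in Metric.ball c N, |x - c| * Real.exp (η * |x - c|) * w x =
      ∫ x, |x - c| * w x * e x := by
    rw [← integral_indicator measurableSet_ball]
    congr 1; funext x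
    by_cases hx : x ∈ Metric.ball c N
    · rw [he, Set.indicator_of_mem hx, Set.indicator_of_mem hx]; ring
    · rw [he, Set.indicator_of_notMem hx, Set.indicator_of_notMem hx]; ring
  rw [fin]
  have := L.trans R
  have h9 : a * (∫ x, |x - c| * w x * e x) ≤
      a * (2 * (∫ x, |x - c| * w x) + 1 / 2 * (Real.exp η * ∫ x, w x)) := by nlinarith
  exact le_of_mul_le_mul_left h9 ha

lemma exMoment (W : Wt J δ β γ a b w) : Ex w := by
  have ha := W.ha
  have hmw := W.meas
  set c := b / a with hc
  set C := (|β| + |γ| + 1) * (1 + |c|) with hCd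
  have hCpos : 0 < C := by positivity
  have hC : ∀ x, pq δ β γ x * w x ≤ C * (1 + |x - c|) * w x := by
    intro x
    have hw := W.nonneg x
    calc pq δ β γ x * w x ≤ |pq δ β γ x| * w x := by gcongr; exact le_abs_self _
      _ ≤ (|β| + |γ|) * (1 + |x|) * w x := W.q_bound x
      _ ≤ C * (1 + |x - c|) * w x := by
        refine mul_le_mul_of_nonneg_right ?_ hw
        have h1 : |x| ≤ |x - c| + |c| := by simpa using abs_add_le (x - c) c
        have h2 : 1 + |x| ≤ (1 + |c|) * (1 + |x - c|) := by
          nlinarith [abs_nonneg c, abs_nonneg (x - c)]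
        rw [hCd, mul_assoc]
        exact mul_le_mul (by linarith) h2 (by positivity) (by positivity)
  set η := a / (4 * C) with hη
  have hηpos : 0 < η := by positivity
  have hηC : η * C = a / 4 := by rw [hη]; field_simp
  refine ⟨η, hηpos, ?_⟩
  set K := 2 * (∫ x, |x - c| * w x) + 1 / 2 * (Real.exp η * ∫ x, w x)
  have hcov : AECover volume atTop (fun N : ℕ => Metric.ball c (N : ℝ)) :=
    aecover_ball tendsto_natCast_atTop_atTop
  have iy : Integrable (fun x => |x - c| * w x) := by
    have := (W.intx.sub (W.int.const_mul c)).norm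
    refine this.congr (Eventually.of_forall fun x => ?_)
    simp only [Pi.sub_apply]
    rw [← sub_mul, norm_mul, Real.norm_eq_abs, Real.norm_of_nonneg (W.nonneg x)]
  have i1 : Integrable (fun x => |x - c| * Real.exp (η * |x - c|) * w x) := by
    refine hcov.integrable_of_integral_norm_bounded K (fun N => ?_) ?_
    · refine (iy.mul_const (Real.exp (η * N))).integrableOn.mono' (by fun_prop) ?_
      rw [ae_restrict_iff' measurableSet_ball]
      refine Eventually.of_forall fun x hx => ?_
      rw [Metric.mem_ball, Real.dist_eq] at hx
      rw [norm_mul, norm_mul, Real.norm_of_nonneg (W.nonneg x), Real.norm_of_nonneg (abs_nonneg _),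
        Real.norm_of_nonneg (Real.exp_pos _).le, mul_right_comm]
      have := W.nonneg x
      gcongr
    · refine Eventually.of_forall fun N => ?_
      refine le_trans (le_of_eq ?_) (W.exp_bound (N := N) hηpos hηC hC)
      congr 1; funext x
      refine Real.norm_of_nonneg ?_
      have := W.nonneg x
      positivity
  refine ((i1.add (W.int.const_mul (Real.exp η))).const_mul (Real.exp (η * |c|))).mono'
    (by fun_prop) (Eventually.of_forall fun x => ?_)
  have hw := W.nonneg x
  rw [norm_mul, Real.norm_of_nonneg (W.nonneg x), Real.norm_of_nonneg (Real.exp_pos _).le]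
  simp only [Pi.add_apply]
  rw [← add_mul, ← mul_assoc]
  refine mul_le_mul_of_nonneg_right ?_ hw
  have h1 : |x| ≤ |x - c| + |c| := by simpa using abs_add_le (x - c) c
  have h2 : Real.exp (η * |x|) ≤ Real.exp (η * |c|) * Real.exp (η * |x - c|) := by
    rw [← Real.exp_add]
    apply Real.exp_le_exp.2
    nlinarith
  refine h2.trans ?_
  gcongr
  by_cases hx : |x - c| ≤ 1
  · have : Real.exp (η * |x - c|) ≤ Real.exp η := by
      apply Real.exp_le_exp.2; nlinarith
    have : 0 ≤ |x - c| * Real.exp (η * |x - c|) := by positivity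
    linarith
  · have := Real.exp_pos η
    have := Real.exp_pos (η * |x - c|)
    nlinarith

end Wt
end PW

namespace PW
open Polynomial
open scoped Interval

variable {J : Set ℝ} {δ β γ a b : ℝ} {w : ℝ → ℝ}

lemma Q_eval (x : ℝ) : (PAlg.Q δ β γ).eval x = pq δ β γ x := by
  simp [PAlg.Q, pq]

lemma Q_deval (x : ℝ) : (derivative (PAlg.Q δ β γ)).eval x = 2 * δ * x + β := by
  simp [PAlg.Q]; ring

namespace Wt

/-- The measure with density `w`. -/
def nu (w : ℝ → ℝ) : Measure ℝ := volume.withDensity (fun x => ENNReal.ofReal (w x))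

lemma nu_int (W : Wt J δ β γ a b w) (k : ℝ → ℝ) :
    Integrable k (nu w) ↔ Integrable (fun x => w x * k x) := by
  unfold nu
  rw [integrable_withDensity_iff_integrable_smul' W.meas.ennreal_ofReal (by simp)]
  simp_rw [ENNReal.toReal_ofReal (W.nonneg _), smul_eq_mul]

lemma nu_integral (W : Wt J δ β γ a b w) (k : ℝ → ℝ) :
    ∫ x, k x ∂(nu w) = ∫ x, w x * k x := by
  unfold nu
  rw [integral_withDensity_eq_integral_toReal_smul W.meas.ennreal_ofReal (by simp)]
  simp_rw [ENNReal.toReal_ofReal (W.nonneg _), smul_eq_mul]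

lemma poly_int (W : Wt J δ β γ a b w) (p : ℝ[X]) : Integrable (fun x => w x * p.eval x) := by
  obtain ⟨η, hη, h⟩ := W.exMoment
  rw [← W.nu_int]
  refine PDens.poly_int hη ?_ p
  rw [W.nu_int]
  simpa only [mul_comm] using h

lemma poly_int' (W : Wt J δ β γ a b w) {k : ℝ → ℝ} (p : ℝ[X])
    (h : ∀ x, k x = w x * p.eval x) : Integrable k := by
  rw [funext h]; exact W.poly_int p

lemma step (W : Wt J δ β γ a b w) :
    Wt J δ β γ (a - 2 * δ) (b + β) (fun x => pq δ β γ x * w x) := by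
  have hmw := W.meas
  have hmq : Measurable (pq δ β γ) := pq_meas
  have hq := fun x => Q_eval (δ := δ) (β := β) (γ := γ) x
  have hdq := fun x => Q_deval (δ := δ) (β := β) (γ := γ) x
  have i1 : Integrable (fun s => pq δ β γ s * w s * (2 * δ * s + β)) :=
    W.poly_int' (PAlg.Q δ β γ * (C (2 * δ) * X + C β)) fun x => by simp [hq]; ring
  have i2 : Integrable (fun x => (a * x - b) * w x * pq δ β γ x) :=
    W.poly_int' (PAlg.Q δ β γ * (C a * X - C b)) fun x => by simp [hq]; ring
  refine ⟨W.op, W.oc, W.ne, W.qpos, W.hδ, ?_, by fun_prop, ?_, ?_, ?_, ?_, ?_, ?_⟩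
  · linarith [W.hδ, W.ha]
  · exact fun x hx => mul_pos (W.qpos x hx) (W.pos x hx)
  · intro x hx; simp [W.off x hx]
  · exact W.poly_int' (PAlg.Q δ β γ) fun x => by rw [hq]; ring
  · exact W.poly_int' (PAlg.Q δ β γ * X) fun x => by simp [hq]; ring
  · intro t
    set ψ : ℝ → ℝ := (Set.Ioi t).indicator (fun x => 2 * δ * x + β) with hψ
    set h : ℝ → ℝ := (Set.Ioi t).indicator (fun x => pq δ β γ x - pq δ β γ t) with hh
    have hii : ∀ u v, IntervalIntegrable ψ volume u v := by
      intro u v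
      have : IntervalIntegrable (fun x => 2 * δ * x + β) volume u v :=
        (by fun_prop : Continuous fun x => 2 * δ * x + β).intervalIntegrable _ _
      rw [intervalIntegrable_iff] at this ⊢
      exact this.indicator measurableSet_Ioi
    have hprim : ∀ x, h x = ∫ s in t..x, ψ s := by
      intro x
      rcases lt_or_ge t x with hx | hx
      · rw [hh, Set.indicator_of_mem (Set.mem_Ioi.2 hx), intervalIntegral.integral_of_le hx.le]
        have : ∫ s in Set.Ioc t x, ψ s = ∫ s in Set.Ioc t x, (2 * δ * s + β) := by
          refine setIntegral_congr_fun measurableSet_Ioc fun s hs => ?_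
          rw [hψ, Set.indicator_of_mem (by exact hs.1)]
        rw [this, ← intervalIntegral.integral_of_le hx.le,
          intervalIntegral.integral_eq_sub_of_hasDerivAt (f := pq δ β γ)]
        · intro s _
          have := (PAlg.Q δ β γ).hasDerivAt s
          simp only [hq, hdq] at this
          exact this
        · exact (by fun_prop : Continuous fun x => 2 * δ * x + β).intervalIntegrable _ _
      · rw [hh, Set.indicator_of_notMem (by simpa using hx), intervalIntegral.integral_of_ge hx]
        rw [setIntegral_congr_fun (g := fun _ => 0) measurableSet_Ioc]
        · simp
        · intro s hs
          rw [hψ, Set.indicator_of_notMem (by simpa using hs.2)]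
    have A : AC J h ψ := by
      refine ⟨Measurable.indicator (by fun_prop) measurableSet_Ioi,
        Measurable.indicator (by fun_prop) measurableSet_Ioi, fun u _ v _ => hii u v, ?_⟩
      intro u _ v _
      rw [hprim, hprim, intervalIntegral.integral_interval_sub_left (hii _ _) (hii _ _)]
    have e1 : (fun s => pq δ β γ s * w s * ψ s) =
        (Set.Ioi t).indicator (fun s => pq δ β γ s * w s * (2 * δ * s + β)) := by
      funext s
      by_cases hs : s ∈ Set.Ioi t
      · rw [hψ, Set.indicator_of_mem hs, Set.indicator_of_mem hs]
      · rw [hψ, Set.indicator_of_notMem hs, Set.indicator_of_notMem hs, mul_zero]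
    have e2 : (fun x => (a * x - b) * w x * h x) =
        (Set.Ioi t).indicator (fun x => (a * x - b) * w x * (pq δ β γ x - pq δ β γ t)) := by
      funext s
      by_cases hs : s ∈ Set.Ioi t
      · rw [hh, Set.indicator_of_mem hs, Set.indicator_of_mem hs]
      · rw [hh, Set.indicator_of_notMem hs, Set.indicator_of_notMem hs, mul_zero]
    have hS := (W.stein1 A (by rw [e1]; exact i1.indicator measurableSet_Ioi)).2
    rw [e1, e2, integral_indicator measurableSet_Ioi, integral_indicator measurableSet_Ioi] at hS
    have i3 : Integrable (fun x => (a * x - b) * w x * (pq δ β γ x - pq δ β γ t)) := by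
      refine (i2.sub (W.intl.mul_const (pq δ β γ t))).congr (Eventually.of_forall fun x => ?_)
      simp only [Pi.sub_apply]; ring
    have e3 : ∀ x, ((a - 2 * δ) * x - (b + β)) * (pq δ β γ x * w x) =
        ((a * x - b) * w x * (pq δ β γ x - pq δ β γ t) - pq δ β γ x * w x * (2 * δ * x + β)) +
          pq δ β γ t * ((a * x - b) * w x) := by intro x; ring
    simp_rw [e3]
    have i4 : Integrable (fun x => (a * x - b) * w x * (pq δ β γ x - pq δ β γ t) -
      pq δ β γ x * w x * (2 * δ * x + β)) := i3.sub i1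
    rw [integral_add i4.integrableOn (W.intl.const_mul _).integrableOn,
      integral_sub i3.integrableOn i1.integrableOn, integral_const_mul, W.right, hS]
    ring
  · have A := AC.poly J (PAlg.Q δ β γ)
    simp only [hq, hdq] at A
    have hS := (W.stein1 A i1).2
    have e3 : ∀ x, ((a - 2 * δ) * x - (b + β)) * (pq δ β γ x * w x) =
        ((a * x - b) * w x * pq δ β γ x - pq δ β γ x * w x * (2 * δ * x + β)) := by intro x; ring
    simp_rw [e3]
    rw [integral_sub i2 i1, hS, sub_self]

lemma iter {f : ℝ → ℝ} {μ : ℝ} (W : Wt J δ β γ 1 μ f) (i : ℕ) :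
    Wt J δ β γ (1 - 2 * i * δ) (μ + i * β) (fun x => pq δ β γ x ^ i * f x) := by
  induction i with
  | zero => simpa using W
  | succ i ih =>
    have := ih.step
    convert this using 1
    · push_cast; ring
    · push_cast; ring
    · funext x; ring

/-- Polynomial integrability up to degree `d`. -/
def PI (w ψ : ℝ → ℝ) (d : ℕ) : Prop := ∀ s ≤ d, Integrable (fun x => w x * (ψ x * x ^ s))

lemma PI.poly {ψ : ℝ → ℝ} {d : ℕ} (H : PI w ψ d) (r : ℝ[X]) (hr : r.natDegree ≤ d) :
    Integrable (fun x => w x * (ψ x * r.eval x)) := by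
  have : (fun x => w x * (ψ x * r.eval x)) =
      fun x => ∑ s ∈ Finset.range (d + 1), r.coeff s * (w x * (ψ x * x ^ s)) := by
    funext x
    rw [eval_eq_sum_range' (n := d + 1) (by omega), mul_sum, mul_sum]
    refine sum_congr rfl fun s _ => ?_
    ring
  rw [this]
  exact integrable_finsetSum _ fun s hs => (H s (by simp at hs; omega)).const_mul _

lemma PI_up (W : Wt J δ β γ a b w) {h ψ : ℝ → ℝ} (A : AC J h ψ) {d : ℕ}
    (H : PI (fun x => pq δ β γ x * w x) ψ d) : PI w h (d + 1) := by
  have hmh := A.mh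
  intro s
  induction s using Nat.strong_induction_on with
  | _ s ih =>
  intro hs
  rcases s with _ | s
  · have := W.stein2 A (by simpa using H 0 (by omega))
    simpa using this
  · have B := A.mul_poly W.oc (X ^ s : ℝ[X])
    have hin : Integrable (fun x => pq δ β γ x * w x * (ψ x * (X ^ s : ℝ[X]).eval x +
        h x * (derivative (X ^ s : ℝ[X])).eval x)) := by
      have j1 := H s (by omega)
      have j2 : Integrable (fun x => pq δ β γ x * w x * (h x * x ^ (s - 1))) := by
        refine W.int_q (by fun_prop) (ih (s - 1) (by omega) (by omega)) ?_
        rcases s with _ | s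
        · have h0 := ih 0 (by omega) (by omega)
          have h1 := (W.stein1 A (by simpa using H 0 (by omega))).1
          have := (h1.add (h0.const_mul b)).const_mul a⁻¹
          refine this.congr (Eventually.of_forall fun x => ?_)
          have := W.ha.ne'
          simp only [Pi.add_apply]
          field_simp
          simp
          ring
        · have := ih (s + 1) (by omega) (by omega)
          refine this.congr (Eventually.of_forall fun x => ?_)
          simp only [Nat.add_sub_cancel]; ring
      refine (j1.add (j2.const_mul (s : ℝ))).congr (Eventually.of_forall fun x => ?_)
      simp only [Pi.add_apply, eval_pow, eval_X, derivative_X_pow, eval_mul, eval_C]; ring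
    have h1 := (W.stein1 B hin).1
    have h0 := ih s (by omega) (by omega)
    have := (h1.add (h0.const_mul b)).const_mul a⁻¹
    refine this.congr (Eventually.of_forall fun x => ?_)
    have := W.ha.ne'
    simp only [Pi.add_apply, eval_pow, eval_X]
    field_simp
    ring

lemma PI_id (W : Wt J δ β γ a b w) {h ψ : ℝ → ℝ} (A : AC J h ψ) {d : ℕ}
    (H : PI (fun x => pq δ β γ x * w x) ψ d) (r : ℝ[X]) (hr : r.natDegree ≤ d) :
    ∫ x, pq δ β γ x * w x * (ψ x * r.eval x) =
      ∫ x, w x * (h x * ((C a * X - C b) * r - PAlg.Q δ β γ * derivative r).eval x) := by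
  have H1 := W.PI_up A H
  have B := A.mul_poly W.oc r
  have j1 := H.poly r hr
  have hdQ : (PAlg.Q δ β γ).natDegree ≤ 2 := by
    unfold PAlg.Q; compute_degree
  have j2 : Integrable (fun x => pq δ β γ x * w x * (h x * (derivative r).eval x)) := by
    by_cases h0 : r.natDegree = 0
    · have : derivative r = 0 := by rw [eq_C_of_natDegree_eq_zero h0]; simp
      simp [this]
    have hd : (PAlg.Q δ β γ * derivative r).natDegree ≤ d + 1 := by
      refine natDegree_mul_le.trans ?_
      have := natDegree_derivative_lt h0
      omega
    refine (H1.poly _ hd).congr (Eventually.of_forall fun x => ?_)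
    simp only [eval_mul, Q_eval]; ring
  have j3 : Integrable (fun x => pq δ β γ x * w x * (ψ x * r.eval x +
        h x * (derivative r).eval x)) := by
    refine (j1.add j2).congr (Eventually.of_forall fun x => ?_)
    simp only [Pi.add_apply]; ring
  obtain ⟨s1, s2⟩ := W.stein1 B j3
  have e1 : ∫ x, pq δ β γ x * w x * (ψ x * r.eval x) =
      (∫ x, pq δ β γ x * w x * (ψ x * r.eval x + h x * (derivative r).eval x)) -
      ∫ x, pq δ β γ x * w x * (h x * (derivative r).eval x) := by
    rw [← integral_sub j3 j2]; congr 1; funext x; ring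
  rw [e1, ← s2, ← integral_sub s1 j2]
  congr 1; funext x
  simp only [eval_sub, eval_mul, eval_C, eval_X, Q_eval]; ring

end Wt
end PW

namespace PW
open Polynomial
open scoped Interval

lemma meas_primitive (g : ℝ → ℝ) : Measurable (fun x => ∫ t in Set.Iic x, g t) := by
  set A : Set ℝ := {x | IntegrableOn g (Set.Iic x) volume} with hA
  set B : Set ℝ := ⋃ r : {r : ℚ // ((r : ℝ)) ∈ A}, Set.Iic ((r.1 : ℚ) : ℝ) with hB
  have hlow : ∀ x ∈ A, ∀ y, y ≤ x → y ∈ A := fun x hx y hy =>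
    IntegrableOn.mono_set (show IntegrableOn g (Set.Iic x) volume from hx) (Set.Iic_subset_Iic.2 hy)
  have hBm : MeasurableSet B := MeasurableSet.iUnion fun _ => measurableSet_Iic
  have hBA : B ⊆ A := by
    intro x hx
    obtain ⟨r, hr⟩ := Set.mem_iUnion.1 hx
    exact hlow _ r.2 _ hr
  have hBl : ∀ x ∈ B, Set.Iic x ⊆ B := by
    intro x hx y hy
    obtain ⟨r, hr⟩ := Set.mem_iUnion.1 hx
    exact Set.mem_iUnion.2 ⟨r, Set.mem_Iic.2 (le_trans (Set.mem_Iic.1 hy) (Set.mem_Iic.1 hr))⟩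
  have hg : AEStronglyMeasurable g (volume.restrict B) := by
    rw [hB, aestronglyMeasurable_iUnion_iff]
    intro r
    exact (show IntegrableOn g (Set.Iic ((r.1 : ℚ) : ℝ)) volume from r.2).aestronglyMeasurable
  set g' := hg.mk g with hg'
  have hg'm : Measurable g' := hg.stronglyMeasurable_mk.measurable
  have hF' : Measurable (fun x => ∫ t, (Set.Iic x).indicator g' t) := by
    have : StronglyMeasurable (fun p : ℝ × ℝ => (Set.Iic p.1).indicator g' p.2) := by
      apply Measurable.stronglyMeasurable
      have e : (fun p : ℝ × ℝ => (Set.Iic p.1).indicator g' p.2) =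
          {p : ℝ × ℝ | p.2 ≤ p.1}.indicator (fun p => g' p.2) := by
        funext p
        by_cases hp : p.2 ≤ p.1
        · rw [Set.indicator_of_mem (Set.mem_Iic.2 hp), Set.indicator_of_mem (by exact hp)]
        · rw [Set.indicator_of_notMem (by simpa using hp), Set.indicator_of_notMem (by exact hp)]
      rw [e]
      exact Measurable.indicator (by fun_prop) (measurableSet_le (by fun_prop) (by fun_prop))
    exact this.integral_prod_right.measurable
  refine Measurable.measurable_of_countable_ne (hF'.indicator hBm) ?_
  refine Set.Countable.mono (s₂ := A \ B) ?_ ?_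
  · intro x hx
    by_contra hn
    apply hx
    by_cases hxB : x ∈ B
    · rw [Set.indicator_of_mem hxB, integral_indicator measurableSet_Iic]
      refine (setIntegral_congr_ae measurableSet_Iic ?_).symm
      have := hg.ae_eq_mk
      rw [Filter.EventuallyEq, ae_restrict_iff' hBm] at this
      filter_upwards [this] with t ht htx
      exact ht (hBl x hxB htx)
    · rw [Set.indicator_of_notMem hxB, integral_undef]
      intro h
      exact hn ⟨h, hxB⟩
  · apply Set.Subsingleton.countable
    have key : ∀ x ∈ A \ B, ∀ y ∈ A \ B, ¬ x < y := by
      intro x hx y hy hxy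
      obtain ⟨r, hr1, hr2⟩ := exists_rat_btwn hxy
      exact hx.2 (Set.mem_iUnion.2 ⟨⟨r, hlow y hy.1 _ hr2.le⟩, hr1.le⟩)
    intro x hx y hy
    exact le_antisymm (not_lt.1 (key y hy x hx)) (not_lt.1 (key x hx y hy))

lemma f_meas {f : ℝ → ℝ} {μ δ β γ : ℝ} (h0 : 0 < |δ| + |β| + |γ|)
    (h : ∀ x : ℝ, (∫ t in Set.Iic x, (μ - t) * f t) = pq δ β γ x * f x) : Measurable f := by
  have hF := meas_primitive (fun t => (μ - t) * f t)
  have hmq : Measurable (pq δ β γ) := Wt.pq_meas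
  refine Measurable.measurable_of_countable_ne (hF.div hmq) ?_
  have hQ : PAlg.Q δ β γ ≠ 0 := by
    intro hQ
    have c0 := congrArg (fun p => coeff p 0) hQ
    have c1 := congrArg (fun p => coeff p 1) hQ
    have c2 := congrArg (fun p => coeff p 2) hQ
    simp [PAlg.Q, coeff_X, coeff_C] at c0 c1 c2
    simp [c0, c1, c2] at h0
  refine Set.Countable.mono ?_ ((PAlg.Q δ β γ).roots.toFinset.finite_toSet.countable)
  intro x hx
  simp only [Finset.mem_coe, Multiset.mem_toFinset, mem_roots hQ, IsRoot, Q_eval]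
  by_contra hq
  apply hx
  simp only [Pi.div_apply, h x]
  field_simp

lemma erealIoo_open (α ω : EReal) : IsOpen (erealIoo α ω) := by
  unfold erealIoo
  exact (isOpen_Ioi.preimage continuous_coe_real_ereal).inter
    (isOpen_Iio.preimage continuous_coe_real_ereal)

lemma erealIoo_oc (α ω : EReal) : (erealIoo α ω).OrdConnected := by
  refine ⟨fun x hx y hy z hz => ⟨hx.1.trans_le ?_, lt_of_le_of_lt ?_ hy.2⟩⟩
  · exact_mod_cast hz.1
  · exact_mod_cast hz.2

lemma base {P : Measure ℝ} {f : ℝ → ℝ} {μ δ β γ : ℝ} (hδ : δ ≤ 0)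
    (hIP : IsIntegratedPearson P f μ δ β γ)
    {α ω : EReal} (hsupp : {x : ℝ | 0 < f x} = erealIoo α ω) :
    Wt (erealIoo α ω) δ β γ 1 μ f ∧ ∫ x, f x = 1 ∧ P = Wt.nu f := by
  obtain ⟨hP, hf0, hPf, hX, hμ, hne, hF⟩ := hIP
  have hm := f_meas hne hF
  have hfi : Integrable f ∧ ∫ x, f x = 1 := by
    have h1 : ∫⁻ x, ENNReal.ofReal (f x) = 1 := by
      have := hP.measure_univ
      rwa [hPf, withDensity_apply _ MeasurableSet.univ, Measure.restrict_univ] at this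
    constructor
    · refine ⟨hm.aestronglyMeasurable, ?_⟩
      rw [hasFiniteIntegral_iff_ofReal (Eventually.of_forall hf0), h1]; simp
    · rw [integral_eq_lintegral_of_nonneg_ae (Eventually.of_forall hf0) hm.aestronglyMeasurable, h1]
      simp
  have hxf : Integrable (fun x => x * f x) := by
    rw [hPf, integrable_withDensity_iff_integrable_smul' hm.ennreal_ofReal (by simp)] at hX
    simp_rw [ENNReal.toReal_ofReal (hf0 _), smul_eq_mul] at hX
    simpa only [mul_comm] using hX
  have hμ2 : ∫ x, x * f x = μ := by
    rw [hPf, integral_withDensity_eq_integral_toReal_smul hm.ennreal_ofReal (by simp)] at hμ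
    simp_rw [ENNReal.toReal_ofReal (hf0 _), smul_eq_mul] at hμ
    rw [hμ]; simp only [mul_comm]
  have hl : Integrable (fun x => (x - μ) * f x) := by
    refine (hxf.sub (hfi.1.const_mul μ)).congr (Eventually.of_forall fun x => ?_)
    simp only [Pi.sub_apply]; ring
  have htot : ∫ x, (x - μ) * f x = 0 := by
    simp_rw [sub_mul]
    rw [integral_sub hxf (hfi.1.const_mul μ), integral_const_mul, hμ2, hfi.2]; simp
  have hright : ∀ t, ∫ x in Set.Ioi t, (x - μ) * f x = pq δ β γ t * f t := by
    intro t
    have h1 := intervalIntegral.integral_Iic_add_Ioi (b := t) hl.integrableOn hl.integrableOn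
    rw [htot] at h1
    have h2 : ∫ x in Set.Iic t, (μ - x) * f x = - ∫ x in Set.Iic t, (x - μ) * f x := by
      rw [← integral_neg]; congr 1; funext x; ring
    rw [hF] at h2
    linarith
  have hop := erealIoo_open α ω
  have hpos : ∀ x ∈ erealIoo α ω, 0 < f x := fun x hx => by rw [← hsupp] at hx; exact hx
  refine ⟨⟨hop, erealIoo_oc α ω, ?_, ?_, hδ, one_pos, hm, hpos, ?_, hfi.1, hxf, ?_, ?_⟩, hfi.2, hPf⟩
  · by_contra hne
    rw [Set.not_nonempty_iff_eq_empty, ← hsupp] at hne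
    have : f = 0 := by
      funext x
      refine le_antisymm (not_lt.1 fun hx => ?_) (hf0 x)
      have : x ∈ {x : ℝ | 0 < f x} := hx
      rw [hne] at this; exact this
    have h2 := hfi.2
    rw [this] at h2
    simp at h2
  · intro t ht
    obtain ⟨ε, hε, hsub⟩ := Metric.isOpen_iff.1 hop t ht
    have hp : 0 < pq δ β γ t * f t := by
      rcases le_total t μ with h | h
      · rw [← hF]
        have hi : IntegrableOn (fun x => (μ - x) * f x) (Set.Iic t) := by
          refine (hl.neg.congr (Eventually.of_forall fun x => ?_)).integrableOn
          simp only [Pi.neg_apply]; ring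
        rw [setIntegral_pos_iff_support_of_nonneg_ae _ hi]
        · refine lt_of_lt_of_le ?_ (measure_mono (s := Set.Ioo (t - ε) t) fun x hx => ⟨?_, hx.2.le⟩)
          · simp [hε]
          · refine (mul_pos (by linarith [hx.2]) (hpos x (hsub ?_))).ne'
            rw [Metric.mem_ball, Real.dist_eq, abs_lt]
            constructor <;> linarith [hx.1, hx.2]
        · rw [Filter.EventuallyLE, ae_restrict_iff' measurableSet_Iic]
          refine Eventually.of_forall fun x hx => mul_nonneg ?_ (hf0 x)
          rw [Set.mem_Iic] at hx; linarith
      · rw [← hright]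
        rw [setIntegral_pos_iff_support_of_nonneg_ae _ hl.integrableOn]
        · refine lt_of_lt_of_le ?_ (measure_mono (s := Set.Ioo t (t + ε)) fun x hx => ⟨?_, hx.1⟩)
          · simp [hε]
          · refine (mul_pos (by linarith [hx.1]) (hpos x (hsub ?_))).ne'
            rw [Metric.mem_ball, Real.dist_eq, abs_lt]
            constructor <;> linarith [hx.1, hx.2]
        · rw [Filter.EventuallyLE, ae_restrict_iff' measurableSet_Ioi]
          refine Eventually.of_forall fun x hx => mul_nonneg ?_ (hf0 x)
          rw [Set.mem_Ioi] at hx; linarith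
    exact pos_of_mul_pos_left hp (hf0 t)
  · intro x hx
    refine le_antisymm (not_lt.1 fun h => hx ?_) (hf0 x)
    rw [← hsupp]; exact h
  · intro t; simpa using hright t
  · simpa using htot

end PW

namespace PW
open Polynomial
open scoped Interval

variable {J : Set ℝ} {δ β γ a b : ℝ} {w : ℝ → ℝ}

lemma exists_antideriv (p : ℝ[X]) : ∃ P : ℝ[X], derivative P = p := by
  induction p using Polynomial.induction_on' with
  | add p q hp hq =>
    obtain ⟨P, hP⟩ := hp
    obtain ⟨R, hR⟩ := hq
    exact ⟨P + R, by rw [derivative_add, hP, hR]⟩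
  | monomial n c =>
    refine ⟨monomial (n + 1) (c / (n + 1)), ?_⟩
    rw [derivative_monomial]
    have : ((n : ℝ) + 1) ≠ 0 := by positivity
    simp only [Nat.add_sub_cancel]
    congr 1
    push_cast
    field_simp

namespace Wt

lemma rod {f : ℝ → ℝ} {μ : ℝ} (W : Wt J δ β γ 1 μ f) (i : ℕ) : ∀ (d : ℕ) (r : ℝ[X]),
    r.natDegree ≤ d → ∃ R : ℝ[X], ∀ hd : ℕ → ℝ → ℝ, (∀ k < i, AC J (hd k) (hd (k + 1))) →
      PI (fun x => pq δ β γ x ^ i * f x) (hd i) d →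
      ∫ x, pq δ β γ x ^ i * f x * (hd i x * r.eval x) = ∫ x, f x * (hd 0 x * R.eval x) := by
  induction i with
  | zero => intro d r hr; exact ⟨r, fun hd _ _ => by simp⟩
  | succ i ih =>
    intro d r hr
    set r' : ℝ[X] := (C (1 - 2 * i * δ) * X - C (μ + i * β)) * r - PAlg.Q δ β γ * derivative r with hr'
    have hdeg : r'.natDegree ≤ d + 1 := by
      have hdQ : (PAlg.Q δ β γ).natDegree ≤ 2 := by
        unfold PAlg.Q; compute_degree
      have h1 : (C (1 - 2 * i * δ) * X - C (μ + i * β) : ℝ[X]).natDegree ≤ 1 := by compute_degree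
      refine (natDegree_sub_le _ _).trans (max_le ?_ ?_)
      · exact natDegree_mul_le.trans (by omega)
      · by_cases h0 : r.natDegree = 0
        · have : derivative r = 0 := by rw [eq_C_of_natDegree_eq_zero h0]; simp
          simp [this]
        · refine natDegree_mul_le.trans ?_
          have := natDegree_derivative_lt h0
          omega
    obtain ⟨R, hR⟩ := ih (d + 1) r' hdeg
    refine ⟨R, fun hd hc H => ?_⟩
    have e : (fun x => pq δ β γ x ^ (i + 1) * f x) =
        fun x => pq δ β γ x * (pq δ β γ x ^ i * f x) := by funext x; ring
    rw [e] at H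
    have A := hc i (by omega)
    have h1 := (W.iter i).PI_id A H r hr
    rw [← hR hd (fun k hk => hc k (by omega)) ((W.iter i).PI_up A H), ← h1]
    congr 1; funext x; ring

lemma approx (n : ℕ) : ∀ {a b : ℝ} {w : ℝ → ℝ} (_ : Wt J δ β γ a b w) (hd : ℕ → ℝ → ℝ)
    (_ : Measurable (hd n)) (_ : ∀ k < n, AC J (hd k) (hd (k + 1)))
    (_ : Integrable (fun x => pq δ β γ x ^ n * w x * hd n x ^ 2)) (ε : ℝ) (_ : 0 < ε),
    ∃ p : ℝ[X], ∀ i ≤ n,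
      Integrable (fun x => pq δ β γ x ^ i * w x * (hd i x - (derivative^[i] p).eval x) ^ 2) ∧
      ∫ x, pq δ β γ x ^ i * w x * (hd i x - (derivative^[i] p).eval x) ^ 2 < ε := by
  induction n with
  | zero =>
    intro a b w W hd hm _ hi ε hε
    obtain ⟨η, hη, he⟩ := W.exMoment
    have he' : Integrable (fun x => Real.exp (η * |x|)) (nu w) := by
      rw [W.nu_int]; simpa only [mul_comm] using he
    have hL : MemLp (hd 0) 2 (nu w) := by
      rw [memLp_two_iff_integrable_sq hm.aestronglyMeasurable, W.nu_int]
      simpa using hi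
    obtain ⟨p, hp⟩ := PDens.poly_dense hη he' hL hε
    refine ⟨p, fun i hi0 => ?_⟩
    obtain rfl : i = 0 := by omega
    have h2 := (hL.sub (PDens.poly_memLp hη he' p)).integrable_sq
    rw [W.nu_int] at h2
    rw [W.nu_integral] at hp
    simpa using ⟨h2, hp⟩
  | succ n ih =>
    intro a b w W hd hm hc hi ε hε
    have ha := W.ha
    obtain ⟨p, hp⟩ := ih W.step (fun k => hd (k + 1)) hm (fun k hk => hc (k + 1) (by omega))
      (hi.congr (Eventually.of_forall fun x => by simp only; ring)) (min ε (a * ε)) (by positivity)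
    obtain ⟨P0, hP0⟩ := exists_antideriv p
    set P : ℝ[X] := P0 + C (hd 0 (b / a) - P0.eval (b / a)) with hP
    have hdP : derivative P = p := by rw [hP, derivative_add, derivative_C, add_zero, hP0]
    refine ⟨P, fun i hin => ?_⟩
    rcases i with _ | i
    · have A := (hc 0 (by omega)).sub (AC.poly J P)
      have h0 := hp 0 (by omega)
      rw [hdP] at A
      simp only [pow_zero, one_mul, Function.iterate_zero, id_eq, zero_add] at h0 A ⊢
      have h3 := W.poincare A h0.1
      have e : hd 0 (b / a) - P.eval (b / a) = 0 := by simp [hP]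
      simp only [e, sub_zero] at h3
      refine ⟨h3.1, ?_⟩
      have := h0.2.trans_le (min_le_right _ _)
      exact lt_of_mul_lt_mul_left (h3.2.trans_lt this) ha.le
    · have h0 := hp i (by omega)
      have e : ∀ x, pq δ β γ x ^ (i + 1) * w x * (hd (i + 1) x - (derivative^[i + 1] P).eval x) ^ 2 =
          pq δ β γ x ^ i * (pq δ β γ x * w x) * (hd (i + 1) x - (derivative^[i] p).eval x) ^ 2 := by
        intro x
        rw [Function.iterate_succ_apply, hdP]; ring
      simp only [e]
      exact ⟨h0.1, h0.2.trans_le (min_le_left _ _)⟩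

lemma cs (W : Wt J δ β γ a b w) {u v : ℝ → ℝ} (hu : Measurable u) (hv : Measurable v)
    (iu : Integrable (fun x => w x * u x ^ 2)) (iv : Integrable (fun x => w x * v x ^ 2)) :
    Integrable (fun x => w x * (u x * v x)) ∧
    (∫ x, w x * (u x * v x)) ^ 2 ≤ (∫ x, w x * u x ^ 2) * ∫ x, w x * v x ^ 2 := by
  have hmw := W.meas
  have iuv : Integrable (fun x => w x * (u x * v x)) := by
    refine (iu.add iv).mono' (by fun_prop) (Eventually.of_forall fun x => ?_)
    simp only [Pi.add_apply]
    rw [norm_mul, Real.norm_of_nonneg (W.nonneg x), ← mul_add, Real.norm_eq_abs]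
    refine mul_le_mul_of_nonneg_left ?_ (W.nonneg x)
    rw [abs_le]; constructor <;> nlinarith [sq_nonneg (u x + v x), sq_nonneg (u x - v x)]
  refine ⟨iuv, ?_⟩
  have hd : discrim (∫ x, w x * u x ^ 2) (2 * ∫ x, w x * (u x * v x)) (∫ x, w x * v x ^ 2) ≤ 0 := by
    refine discrim_le_zero fun t => ?_
    have : (∫ x, w x * u x ^ 2) * (t * t) + (2 * ∫ x, w x * (u x * v x)) * t +
        (∫ x, w x * v x ^ 2) = ∫ x, w x * (t * u x + v x) ^ 2 := by
      have e : ∀ x, w x * (t * u x + v x) ^ 2 =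
        (t * t) * (w x * u x ^ 2) + (2 * t) * (w x * (u x * v x)) + w x * v x ^ 2 := by intro x; ring
      simp_rw [e]
      have i2 : Integrable (fun x => (t * t) * (w x * u x ^ 2) + (2 * t) * (w x * (u x * v x))) :=
        (iu.const_mul _).add (iuv.const_mul _)
      rw [integral_add i2 iv,
        integral_add (iu.const_mul _) (iuv.const_mul _), integral_const_mul, integral_const_mul]
      ring
    rw [this]
    exact integral_nonneg fun x => mul_nonneg (W.nonneg x) (sq_nonneg _)
  unfold discrim at hd
  nlinarith

lemma poly_sq (W : Wt J δ β γ a b w) (p : ℝ[X]) : Integrable (fun x => w x * (p.eval x) ^ 2) :=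
  W.poly_int' (p ^ 2) fun x => by simp

lemma l2_of (W : Wt J δ β γ a b w) {h : ℝ → ℝ} (hm : Measurable h) {p : ℝ[X]}
    (hi : Integrable (fun x => w x * (h x - p.eval x) ^ 2)) : Integrable (fun x => w x * h x ^ 2) := by
  have c := (W.cs (u := fun x => h x - p.eval x) (by fun_prop) (v := fun x => p.eval x) (by fun_prop) hi (W.poly_sq p)).1
  refine ((hi.add (c.const_mul 2)).add (W.poly_sq p)).congr (Eventually.of_forall fun x => ?_)
  simp only [Pi.add_apply]; ring

lemma tend_lin (W : Wt J δ β γ a b w) {h v : ℝ → ℝ} (hm : Measurable h) (hv : Measurable v)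
    (iv : Integrable (fun x => w x * v x ^ 2)) {p : ℕ → ℝ[X]}
    (hi : ∀ N, Integrable (fun x => w x * (h x - (p N).eval x) ^ 2))
    (ht : Tendsto (fun N => ∫ x, w x * (h x - (p N).eval x) ^ 2) atTop (nhds 0)) :
    Tendsto (fun N => ∫ x, w x * ((p N).eval x * v x)) atTop (nhds (∫ x, w x * (h x * v x))) := by
  have ih := W.l2_of hm (hi 0)
  have c1 := (W.cs hm hv ih iv).1
  have c2 := fun N => W.cs (u := fun x => h x - (p N).eval x) (by fun_prop) hv (hi N) iv
  have z : Tendsto (fun N => ∫ x, w x * ((h x - (p N).eval x) * v x)) atTop (nhds 0) := by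
    have h2 : Tendsto (fun N => Real.sqrt ((∫ x, w x * (h x - (p N).eval x) ^ 2) * ∫ x, w x * v x ^ 2))
        atTop (nhds 0) := by
      have := (ht.mul_const (∫ x, w x * v x ^ 2)).sqrt
      simpa using this
    refine squeeze_zero_norm (fun N => ?_) h2
    exact Real.abs_le_sqrt (c2 N).2
  have := z.const_sub (∫ x, w x * (h x * v x))
  rw [sub_zero] at this
  refine this.congr fun N => ?_
  rw [← integral_sub c1 (c2 N).1]
  congr 1; funext x; ring

lemma tend_sq (W : Wt J δ β γ a b w) {h : ℝ → ℝ} (hm : Measurable h) {p : ℕ → ℝ[X]}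
    (hi : ∀ N, Integrable (fun x => w x * (h x - (p N).eval x) ^ 2))
    (ht : Tendsto (fun N => ∫ x, w x * (h x - (p N).eval x) ^ 2) atTop (nhds 0)) :
    Tendsto (fun N => ∫ x, w x * ((p N).eval x) ^ 2) atTop (nhds (∫ x, w x * h x ^ 2)) := by
  have ih := W.l2_of hm (hi 0)
  have t := W.tend_lin hm hm ih hi ht
  have c1 := fun N => (W.cs (u := fun x => (p N).eval x) (by fun_prop) hm (W.poly_sq (p N)) ih).1
  have t2 := ((t.const_mul 2).add ht).sub_const (∫ x, w x * h x ^ 2)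
  have e : 2 * (∫ x, w x * (h x * h x)) + 0 - ∫ x, w x * h x ^ 2 = ∫ x, w x * h x ^ 2 := by
    simp_rw [← pow_two]; ring
  rw [e] at t2
  refine t2.congr fun N => ?_
  have i2 : Integrable (fun x => 2 * (w x * ((p N).eval x * h x)) + w x * (h x - (p N).eval x) ^ 2) :=
    ((c1 N).const_mul 2).add (hi N)
  rw [← integral_const_mul, ← integral_add ((c1 N).const_mul 2) (hi N), ← integral_sub i2 ih]
  congr 1; funext x; ring

end Wt
end PW

namespace PW
open Polynomial
open scoped Interval

variable {J : Set ℝ} {δ β γ a b : ℝ} {w : ℝ → ℝ}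

namespace Wt

/-- The moment functional. -/
def mom (W : Wt J δ β γ a b w) : ℝ[X] →ₗ[ℝ] ℝ where
  toFun p := ∫ x, w x * p.eval x
  map_add' p q := by
    rw [← integral_add (W.poly_int p) (W.poly_int q)]
    congr 1; funext x; simp only [eval_add]; ring
  map_smul' c p := by
    simp only [eval_smul, smul_eq_mul, RingHom.id_apply]
    rw [← integral_const_mul]
    congr 1; funext x; ring

lemma mom_apply (W : Wt J δ β γ a b w) (p : ℝ[X]) : W.mom p = ∫ x, w x * p.eval x := rfl

lemma core {f : ℝ → ℝ} {μ : ℝ} (W : Wt J δ β γ 1 μ f) (h1 : ∫ x, f x = 1) (m n : ℕ)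
    (hd : ℕ → ℝ → ℝ) (hm : ∀ k, Measurable (hd k))
    (hc : ∀ k < max m n, AC J (hd k) (hd (k + 1)))
    (hn : Integrable (fun x => pq δ β γ x ^ n * f x * hd n x ^ 2))
    (hi : ∀ i, n < i → i ≤ m → Integrable (fun x => pq δ β γ x ^ i * f x * hd i x)) :
    Integrable (fun x => f x * hd 0 x ^ 2) ∧
    0 ≤ (-1 : ℝ) ^ n * ((∫ x, f x * hd 0 x ^ 2) - (∫ x, f x * hd 0 x) ^ 2 -
      ((∑ i ∈ Finset.Icc 1 m,
      ((m.choose i : ℝ) * pp δ ((m : ℝ) + i) n /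
          (fall ((m : ℝ) + n) i * (∫ x, pq δ β γ x ^ i * f x) * pp δ ((i : ℝ) - 1) i *
            pp δ (m : ℝ) n)) *
        (∫ x, pq δ β γ x ^ i * f x * hd i x) ^ 2) +
    ∑ i ∈ Finset.Icc 1 n,
      (-1 : ℝ) ^ (i - 1) *
          ((n.choose i : ℝ) / (fall ((m : ℝ) + n) i * pp δ (m : ℝ) i)) *
        ∫ x, pq δ β γ x ^ i * f x * hd i x ^ 2)) := by
  have hap := fun N : ℕ => approx n W hd (hm n) (fun k hk => hc k (lt_max_of_lt_right hk)) hn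
    (1 / ((N : ℝ) + 1)) (by positivity)
  choose p hp using hap
  have ht : ∀ i ≤ n, Tendsto (fun N => ∫ x, pq δ β γ x ^ i * f x *
      (hd i x - (derivative^[i] (p N)).eval x) ^ 2) atTop (nhds 0) := by
    intro i hin
    refine squeeze_zero (fun N => integral_nonneg fun x => ?_) (fun N => (hp N i hin).2.le)
      tendsto_one_div_add_atTop_nhds_zero_nat
    exact mul_nonneg ((W.iter i).nonneg x) (sq_nonneg _)
  have hsq : ∀ i ≤ n, Tendsto (fun N => ∫ x, pq δ β γ x ^ i * f x *
      ((derivative^[i] (p N)).eval x) ^ 2) atTop (nhds (∫ x, pq δ β γ x ^ i * f x * hd i x ^ 2)) :=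
    fun i hin => (W.iter i).tend_sq (hm i) (fun N => (hp N i hin).1) (ht i hin)
  have hl2 : ∀ i ≤ n, Integrable (fun x => pq δ β γ x ^ i * f x * hd i x ^ 2) :=
    fun i hin => (W.iter i).l2_of (hm i) (hp 0 i hin).1
  have hL1 : ∀ i ≤ max m n, Integrable (fun x => pq δ β γ x ^ i * f x * hd i x) := by
    intro i hin
    rcases le_or_gt i n with h | h
    · have := ((W.iter i).cs (hm i) (v := fun _ => 1) (by fun_prop) (hl2 i h)
        (by simpa using (W.iter i).int)).1
      simpa using this
    · exact hi i h (by omega)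
  have ht0 := ht 0 (by omega)
  have hp0 := fun N => (hp N 0 (by omega)).1
  simp only [pow_zero, one_mul, Function.iterate_zero, id_eq] at ht0 hp0
  have hlin : ∀ i ≤ max m n, Tendsto (fun N => ∫ x, pq δ β γ x ^ i * f x *
      (derivative^[i] (p N)).eval x) atTop (nhds (∫ x, pq δ β γ x ^ i * f x * hd i x)) := by
    intro i hin
    obtain ⟨R, hR⟩ := W.rod i 0 1 (by simp)
    have e1 := hR hd (fun k hk => hc k (by omega)) (by
      intro s hs
      obtain rfl : s = 0 := by omega
      simpa using hL1 i hin)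
    have e2 := fun N => hR (fun k x => (derivative^[k] (p N)).eval x) (fun k hk => by
      have := AC.poly J (derivative^[k] (p N))
      rwa [← Function.iterate_succ_apply' derivative] at this) (by
      intro s hs
      obtain rfl : s = 0 := by omega
      simpa using (W.iter i).poly_int (derivative^[i] (p N)))
    simp only [eval_one, mul_one, Function.iterate_zero, id_eq] at e1 e2
    simp_rw [e1, e2]
    exact W.tend_lin (hm 0) (by fun_prop) (W.poly_sq R) hp0 ht0
  have hI : ∀ N, _ := fun N => PAlg.poly_ineq (δ := δ) (β := β) (γ := γ) (μ := μ) W.hδ W.mom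
    (by
      intro p
      rw [W.mom_apply, W.mom_apply]
      have := (W.stein1 (AC.poly J p) (W.poly_int' (PAlg.Q δ β γ * derivative p) fun x => by
        simp only [eval_mul, Q_eval]; ring)).2
      simp only [eval_mul, eval_sub, eval_X, eval_C, Q_eval]
      rw [show (∫ x, f x * (pq δ β γ x * (derivative p).eval x)) =
        ∫ x, pq δ β γ x * f x * (derivative p).eval x from by congr 1; funext x; ring, ← this]
      congr 1; funext x; ring)
    (by
      intro p
      rw [W.mom_apply]
      refine integral_nonneg fun x => mul_nonneg (W.nonneg x) ?_
      rw [eval_mul]; exact mul_self_nonneg _)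
    (by rw [W.mom_apply]; simpa using h1) m n
    (by
      intro i
      rw [W.mom_apply]
      have := (W.iter i).pos_of (k := fun _ => 1) (by simpa using (W.iter i).int) (fun _ _ => one_pos)
      simp only [one_mul] at this
      refine this.trans_eq ?_
      congr 1; funext x; simp only [eval_pow, Q_eval]; ring) (p N)
  refine ⟨by simpa using hl2 0 (by omega), ?_⟩
  have eQ : ∀ i, W.mom (PAlg.Q δ β γ ^ i) = ∫ x, pq δ β γ x ^ i * f x := by
    intro i; rw [W.mom_apply]; congr 1; funext x; simp only [eval_pow, Q_eval]; ring
  have eL : ∀ i p, W.mom (PAlg.Q δ β γ ^ i * derivative^[i] p) =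
      ∫ x, pq δ β γ x ^ i * f x * (derivative^[i] p).eval x := by
    intro i p; rw [W.mom_apply]; congr 1; funext x; simp only [eval_mul, eval_pow, Q_eval]; ring
  have eS : ∀ i p, W.mom (PAlg.Q δ β γ ^ i * (derivative^[i] p * derivative^[i] p)) =
      ∫ x, pq δ β γ x ^ i * f x * (derivative^[i] p).eval x ^ 2 := by
    intro i p; rw [W.mom_apply]; congr 1; funext x; simp only [eval_mul, eval_pow, Q_eval]; ring
  have e0 := fun p => eL 0 p
  have es0 := fun p => eS 0 p
  simp only [pow_zero, one_mul, Function.iterate_zero, id_eq] at e0 es0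
  simp only [eQ, eL, eS, es0] at hI
  simp only [e0] at hI
  refine ge_of_tendsto' (x := atTop) ?_ hI
  refine Tendsto.const_mul _ (Tendsto.sub (Tendsto.sub ?_ (Tendsto.pow ?_ 2)) (Tendsto.add ?_ ?_))
  · simpa using hsq 0 (by omega)
  · simpa using hlin 0 (by omega)
  · refine tendsto_finsetSum _ fun i h => Tendsto.const_mul _ (Tendsto.pow (hlin i ?_) 2)
    simp at h; omega
  · refine tendsto_finsetSum _ fun i h => Tendsto.const_mul _ (hsq i ?_)
    simp at h; omega

end Wt
end PW

namespace PW

lemma chain {P : Measure ℝ} {q : ℝ → ℝ} {J : Set ℝ} (hop : IsOpen J) (hoc : J.OrdConnected)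
    {m n : ℕ} (hn : 1 ≤ n) {gd : ℕ → ℝ → ℝ} (hg : MemH P q J m n gd) :
    ∃ hd : ℕ → ℝ → ℝ, (∀ k, Measurable (hd k)) ∧ (∀ k < max m n, AC J (hd k) (hd (k + 1))) ∧
      ∀ k ≤ max m n, ∀ᵐ x, x ∈ J → gd k x = hd k x := by
  obtain ⟨g1, g2, g3, -, -⟩ := hg
  have hl : 1 ≤ max m n := le_max_of_le_right hn
  set l := max m n with hldef
  have hJm := hop.measurableSet
  have hcont : ∀ k < l, ContinuousOn (gd k) J := by
    intro k hk
    by_cases h : k + 1 < l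
    · exact fun x hx => (g1 k h x hx).continuousAt.continuousWithinAt
    · obtain rfl : k = l - 1 := by omega
      exact g2 hl
  have hftc : ∀ k < l, ∀ a ∈ J, ∀ b ∈ J, IntervalIntegrable (gd (k + 1)) volume a b ∧
      gd k b - gd k a = ∫ t in a..b, gd (k + 1) t := by
    intro k hk a ha b hb
    by_cases h : k + 1 < l
    · have hs := hoc.uIcc_subset ha hb
      have hii : IntervalIntegrable (gd (k + 1)) volume a b :=
        ((hcont (k + 1) h).mono hs).intervalIntegrable
      refine ⟨hii, ?_⟩
      rw [intervalIntegral.integral_eq_sub_of_hasDerivAt (fun x hx => g1 k h x (hs hx)) hii]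
    · have e1 : k = l - 1 := by omega
      have e2 : k + 1 = l := by omega
      rw [e2, e1]
      exact g3 hl a ha b hb
  have haes : AEStronglyMeasurable (gd l) (volume.restrict J) := by
    have : LocallyIntegrableOn (gd l) J := by
      intro x hx
      obtain ⟨ε, hε, hsub⟩ := Metric.isOpen_iff.1 hop x hx
      have ha : x - ε / 2 ∈ J := hsub (by
        rw [Metric.mem_ball, Real.dist_eq, abs_lt]; constructor <;> linarith)
      have hb : x + ε / 2 ∈ J := hsub (by
        rw [Metric.mem_ball, Real.dist_eq, abs_lt]; constructor <;> linarith)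
      have h3 := (g3 hl _ ha _ hb).1
      rw [intervalIntegrable_iff_integrableOn_Icc_of_le (by linarith)] at h3
      exact ⟨Set.Icc (x - ε / 2) (x + ε / 2),
        mem_nhdsWithin_of_mem_nhds (Icc_mem_nhds (by linarith) (by linarith)), h3⟩
    exact this.aestronglyMeasurable
  have hae : ∀ᵐ x, x ∈ J → gd l x = haes.mk (gd l) x := by
    have := haes.ae_eq_mk
    rwa [Filter.EventuallyEq, ae_restrict_iff' hJm] at this
  set hd : ℕ → ℝ → ℝ := fun k => if k < l then J.indicator (gd k) else J.indicator (haes.mk (gd l))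
    with hhd
  have hmeas : ∀ k, Measurable (hd k) := by
    intro k
    simp only [hhd]
    split_ifs with h
    · classical
      rw [← Set.piecewise_eq_indicator]
      exact ContinuousOn.measurable_piecewise (hcont k h) continuous_zero.continuousOn hJm
    · exact haes.stronglyMeasurable_mk.measurable.indicator hJm
  have hpt : ∀ k < l, ∀ x ∈ J, gd k x = hd k x := by
    intro k hk x hx
    simp only [hhd, if_pos hk, Set.indicator_of_mem hx]
  have heq : ∀ k ≤ l, ∀ᵐ x, x ∈ J → gd k x = hd k x := by
    intro k hk
    rcases hk.lt_or_eq with h | h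
    · exact Eventually.of_forall (hpt k h)
    · filter_upwards [hae] with x hx hxJ
      have : ¬ k < l := by omega
      simp only [hhd, if_neg this, Set.indicator_of_mem hxJ]
      rw [h]; exact hx hxJ
  refine ⟨hd, hmeas, fun k hk => ⟨hmeas k, hmeas _, ?_, ?_⟩, heq⟩
  · intro a ha b hb
    refine (hftc k hk a ha b hb).1.congr_ae ?_
    rw [Filter.EventuallyEq, ae_restrict_iff' measurableSet_uIoc]
    filter_upwards [heq (k + 1) hk] with x hx hxu
    exact hx (hoc.uIcc_subset ha hb (Set.uIoc_subset_uIcc hxu))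
  · intro a ha b hb
    rw [← hpt k hk a ha, ← hpt k hk b hb, (hftc k hk a ha b hb).2]
    refine intervalIntegral.integral_congr_ae ?_
    filter_upwards [heq (k + 1) hk] with x hx hxu
    exact hx (hoc.uIcc_subset ha hb (Set.uIoc_subset_uIcc hxu))

end PW


/-- **Theorem 2.1 (inequality part).** If `X ∼ IP(μ; δ, β, γ)` with `δ ≤ 0`,
`n ≥ 1` and `g ∈ H^{m,n}(X)`, then `(-1)^n (Var g(X) - S_{m,n}(g)) ≥ 0`. -/
theorem pearson_variance_bound
    (P : Measure ℝ) (f : ℝ → ℝ) (μ δ β γ : ℝ) (hδ : δ ≤ 0)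
    (hIP : IsIntegratedPearson P f μ δ β γ)
    (α ω : EReal) (hsupp : {x : ℝ | 0 < f x} = erealIoo α ω)
    (m n : ℕ) (hn : 1 ≤ n) (gd : ℕ → ℝ → ℝ)
    (hg : MemH P (pq δ β γ) (erealIoo α ω) m n gd) :
    0 ≤ (-1 : ℝ) ^ n * (variance (gd 0) P - Sbound P δ (pq δ β γ) m n gd) := by
  obtain ⟨W, h1, hP⟩ := PW.base hδ hIP hsupp
  obtain ⟨hd, hm, hc, heq⟩ := PW.chain W.op W.oc hn hg
  obtain ⟨-, -, -, hg4, hg5⟩ := hg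
  have hae : ∀ k ≤ max m n, gd k =ᵐ[P] hd k := by
    intro k hk
    rw [hP, PW.Wt.nu, Filter.EventuallyEq, ae_withDensity_iff W.meas.ennreal_ofReal]
    filter_upwards [heq k hk] with x hx hfx
    refine hx ?_
    by_contra hxJ
    rw [W.off x hxJ] at hfx
    simp at hfx
  have hmq : Measurable (pq δ β γ) := PW.Wt.pq_meas
  obtain ⟨c1, c2⟩ := W.core h1 m n hd hm hc
    (by
      have : Integrable (fun x => pq δ β γ x ^ n * hd n x ^ 2) P := by
        refine hg4.congr ?_
        filter_upwards [hae n (le_max_right _ _)] with x hx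
        rw [hx]
      rw [hP, W.nu_int] at this
      refine this.congr (Eventually.of_forall fun x => ?_)
      simp only; ring)
    (by
      intro i hi1 hi2
      have : Integrable (fun x => |pq δ β γ x ^ i * hd i x|) P := by
        refine (hg5 i hi1 hi2).abs.congr ?_
        filter_upwards [hae i (le_max_of_le_left hi2)] with x hx
        rw [hx, abs_mul, abs_mul, abs_abs]
      have hmi := hm i
      have h3 := (integrable_norm_iff (f := fun x => pq δ β γ x ^ i * hd i x)
        (by fun_prop)).1 this
      rw [hP, W.nu_int] at h3
      refine h3.congr (Eventually.of_forall fun x => ?_)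
      simp only; ring)
  have hL : MemLp (hd 0) 2 P := by
    rw [memLp_two_iff_integrable_sq (hm 0).aestronglyMeasurable, hP, W.nu_int]
    exact c1
  have := hIP.1
  have ev : variance (gd 0) P = (∫ x, f x * hd 0 x ^ 2) - (∫ x, f x * hd 0 x) ^ 2 := by
    rw [variance_congr (hae 0 (by omega)), variance_eq_sub hL, hP, W.nu_integral, W.nu_integral]
    rfl
  have eQ : ∀ i, ∫ x, pq δ β γ x ^ i ∂P = ∫ x, pq δ β γ x ^ i * f x := by
    intro i
    rw [hP, W.nu_integral]; simp only [mul_comm]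
  have eL : ∀ i ≤ max m n, ∫ x, pq δ β γ x ^ i * gd i x ∂P = ∫ x, pq δ β γ x ^ i * f x * hd i x := by
    intro i hi
    have : ∫ x, pq δ β γ x ^ i * gd i x ∂P = ∫ x, pq δ β γ x ^ i * hd i x ∂P := by
      refine integral_congr_ae ?_
      filter_upwards [hae i hi] with x hx
      rw [hx]
    rw [this, hP, W.nu_integral]
    congr 1; funext x; ring
  have eS : ∀ i ≤ max m n,
      ∫ x, pq δ β γ x ^ i * gd i x ^ 2 ∂P = ∫ x, pq δ β γ x ^ i * f x * hd i x ^ 2 := by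
    intro i hi
    have : ∫ x, pq δ β γ x ^ i * gd i x ^ 2 ∂P = ∫ x, pq δ β γ x ^ i * hd i x ^ 2 ∂P := by
      refine integral_congr_ae ?_
      filter_upwards [hae i hi] with x hx
      rw [hx]
    rw [this, hP, W.nu_integral]
    congr 1; funext x; ring
  rw [ev]
  convert c2 using 3
  unfold Sbound
  congr 1
  · refine Finset.sum_congr rfl fun i hi => ?_
    rw [eQ, eL i (by simp at hi; omega)]
  · refine Finset.sum_congr rfl fun i hi => ?_
    rw [eS i (by simp at hi; omega)]

end
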